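/- arXiv:1207.6898 — 10 statements merged into one kernel-verified Lean document; each statement's English description precedes it below -/
import Mathlib

section
/- For all vectors x, y in ℝ³ one has (|x|·x − |y|·y)·(x − y) ≥ (1/2)|x − y|³, where · on the left denotes the Euclidean inner product. Equivalently, for x ≠ y, the quantity ((|x|²ω_x − |y|²ω_y)·(x − y))/|x − y|³ is bounded below by 1/2, where ω_x denotes the unit vector x/|x|. -/
open scoped RealInnerProductSpace

/-- The map `x ↦ ‖x‖ • x` on a real inner product space is uniformly monotone with cubic modulus. -/
theorem half_norm_sub_pow_three_le_inner_norm_smul_sub {E : Type*} [NormedAddCommGroup E]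
    [InnerProductSpace ℝ E] (x y : E) :
    (1 / 2) * ‖x - y‖ ^ 3 ≤ inner ℝ (‖x‖ • x - ‖y‖ • y) (x - y) := by
  have key : inner ℝ (‖x‖ • x - ‖y‖ • y) (x - y) =
      (‖x‖ + ‖y‖) * ((‖x‖ - ‖y‖) ^ 2 + ‖x - y‖ ^ 2) / 2 := by
    simp only [norm_sub_sq_real, inner_sub_left, inner_sub_right, real_inner_smul_left,
      real_inner_self_eq_norm_sq, real_inner_comm x y]
    ring
  have cubic_le : ‖x - y‖ * ‖x - y‖ ^ 2 ≤ (‖x‖ + ‖y‖) * ‖x - y‖ ^ 2 := by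
    gcongr
    exact norm_sub_le x y
  have nonneg : 0 ≤ (‖x‖ + ‖y‖) * (‖x‖ - ‖y‖) ^ 2 := by positivity
  rw [key]
  linarith

/-- For all vectors `x, y ∈ ℝ³`, `(|x|·x − |y|·y)·(x − y) ≥ (1/2)|x − y|³`. -/
theorem cubic_virial_pointwise_bound (x y : EuclideanSpace ℝ (Fin 3)) :
    ⟪‖x‖ • x - ‖y‖ • y, x - y⟫ ≥ (1 / 2) * ‖x - y‖ ^ 3 :=
  half_norm_sub_pow_three_le_inner_norm_smul_sub x y
end

section
/- For all real numbers r, s with 0 < s < r, the following integral identity holds: (1/2)·∫_{−1}^{1} (r³ + s³ − θ(r²s + rs²)) / (r² + s² − 2rsθ)^{3/2} dθ = 1. -/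
/-- For positive bases, the power `3 / 2` is the base times its square root. -/
lemma rpow_three_halves_eq_mul_sqrt {u : ℝ} (hu : 0 < u) :
    u ^ ((3 : ℝ) / 2) = u * Real.sqrt u := by
  rw [Real.sqrt_eq_rpow, show (3 : ℝ) / 2 = 1 + 1 / 2 by norm_num, Real.rpow_add hu,
    Real.rpow_one]

/-- The cubic virial integrand has the antiderivative `(r + s) * (θ - 1) / |x - y|`. -/
lemma hasDerivAt_cubic_virial_antideriv {r s θ : ℝ} (hu : 0 < r ^ 2 + s ^ 2 - 2 * r * s * θ) :
    HasDerivAt (fun t : ℝ => (r + s) * (t - 1) / Real.sqrt (r ^ 2 + s ^ 2 - 2 * r * s * t))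
      ((r ^ 3 + s ^ 3 - θ * (r ^ 2 * s + r * s ^ 2)) /
        (r ^ 2 + s ^ 2 - 2 * r * s * θ) ^ ((3 : ℝ) / 2)) θ := by
  have hsqrt := Real.sqrt_pos.2 hu
  have hdist : HasDerivAt (fun t : ℝ => r ^ 2 + s ^ 2 - 2 * r * s * t) (-(2 * r * s)) θ := by
    simpa using ((hasDerivAt_id θ).const_mul (2 * r * s)).const_sub (r ^ 2 + s ^ 2)
  have hnum : HasDerivAt (fun t : ℝ => (r + s) * (t - 1)) (r + s) θ := by
    simpa using ((hasDerivAt_id θ).sub_const 1).const_mul (r + s)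
  refine (hnum.div (hdist.sqrt hu.ne') hsqrt.ne').congr_deriv ?_
  rw [rpow_three_halves_eq_mul_sqrt hu, Real.sq_sqrt hu.le]
  have hsq := Real.sq_sqrt hu.le
  set q := Real.sqrt (r ^ 2 + s ^ 2 - 2 * r * s * θ)
  rw [← hsq]
  field_simp
  rw [hsq]
  ring

/-- Spherical-average identity for the cubic virial function in the radial case. -/
theorem cubic_virial_radial_average (r s : ℝ) (hs : 0 < s) (hsr : s < r) :
    (1 / 2) * ∫ θ in (-1 : ℝ)..1,
        (r ^ 3 + s ^ 3 - θ * (r ^ 2 * s + r * s ^ 2)) /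
          (r ^ 2 + s ^ 2 - 2 * r * s * θ) ^ ((3 : ℝ) / 2) = 1 := by
  have hpos : ∀ θ ∈ Set.uIcc (-1 : ℝ) 1, 0 < r ^ 2 + s ^ 2 - 2 * r * s * θ := by
    intro θ hθ
    rw [Set.uIcc_of_le (by norm_num)] at hθ
    have hrs : 0 < r * s := mul_pos (hs.trans hsr) hs
    nlinarith [pow_pos (sub_pos.2 hsr) 2, mul_nonneg hrs.le (sub_nonneg.2 hθ.2)]
  rw [intervalIntegral.integral_eq_sub_of_hasDerivAt
    (fun θ hθ => hasDerivAt_cubic_virial_antideriv (hpos θ hθ))]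
  · have hsum : 0 < r + s := by linarith
    rw [show r ^ 2 + s ^ 2 - 2 * r * s * (-1) = (r + s) ^ 2 by ring, Real.sqrt_sq hsum.le]
    field_simp
    ring
  · refine ContinuousOn.intervalIntegrable (ContinuousOn.div (by fun_prop) ?_ ?_)
    · exact ContinuousOn.rpow_const (by fun_prop) fun θ hθ => Or.inl (hpos θ hθ).ne'
    · exact fun θ hθ => (Real.rpow_pos_of_pos (hpos θ hθ) _).ne'
end

section
/- For all real numbers u and θ with 0 < u ≤ 1, −1 ≤ θ ≤ 1 and (u, θ) ≠ (1, 1), one has (1 + u³ − (u + u²)θ) / (1 + u² − 2uθ)^{3/2} ≥ 1/2, with the minimal value 1/2 attained at u = 1, θ = −1. -/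
theorem Real.rpow_three_halves_eq_sqrt_pow {x : ℝ} (hx : 0 ≤ x) :
    x ^ ((3 : ℝ) / 2) = √x ^ 3 := by
  rw [Real.sqrt_eq_rpow, ← Real.rpow_mul_natCast hx]
  norm_num

/-- Scalar inequality at the heart of Lemma 3.1, with the minimum `1/2`
attained at `u = 1`, `θ = −1`. -/
theorem cubic_virial_scalar_bound :
    (∀ u θ : ℝ, 0 < u → u ≤ 1 → -1 ≤ θ → θ ≤ 1 → (u, θ) ≠ (1, 1) →
        (1 + u ^ 3 - (u + u ^ 2) * θ) / (1 + u ^ 2 - 2 * u * θ) ^ ((3 : ℝ) / 2) ≥ 1 / 2) ∧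
      (1 + (1 : ℝ) ^ 3 - ((1 : ℝ) + 1 ^ 2) * (-1)) /
          (1 + (1 : ℝ) ^ 2 - 2 * 1 * (-1)) ^ ((3 : ℝ) / 2) = 1 / 2 := by
  constructor
  · intro u θ hu hu1 hθ hθ1 hne
    have hD : 0 < 1 + u ^ 2 - 2 * u * θ := by
      rcases hu1.lt_or_eq with h | rfl
      · nlinarith [sq_pos_of_pos (sub_pos.2 h), mul_nonneg hu.le (sub_nonneg.2 hθ1)]
      · have : θ < 1 := lt_of_le_of_ne hθ1 fun h => hne (by rw [h])
        linarith
    rw [Real.rpow_three_halves_eq_sqrt_pow hD.le, ge_iff_le, le_div_iff₀ (by positivity)]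
    have hd : √(1 + u ^ 2 - 2 * u * θ) ≤ 1 + u :=
      Real.sqrt_le_iff.2 ⟨by positivity, by nlinarith⟩
    have hcube : √(1 + u ^ 2 - 2 * u * θ) ^ 3 ≤ (1 + u) * (1 + u ^ 2 - 2 * u * θ) := by
      rw [pow_succ', Real.sq_sqrt hD.le]
      exact mul_le_mul_of_nonneg_right hd hD.le
    have hnum : 2 * (1 + u ^ 3 - (u + u ^ 2) * θ) =
        (1 + u) * (1 + u ^ 2 - 2 * u * θ) + (1 + u) * (1 - u) ^ 2 := by ring
    have : 0 ≤ (1 + u) * (1 - u) ^ 2 := by positivity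
    linarith
  · rw [Real.rpow_three_halves_eq_sqrt_pow (by norm_num),
      show (1 + (1 : ℝ) ^ 2 - 2 * 1 * (-1)) = 2 ^ 2 by norm_num, Real.sqrt_sq (by norm_num)]
    norm_num
end

section
/- For all vectors x, y in ℝ³ one has ( |x|·x/(1 + |x|²) − |y|·y/(1 + |y|²) ) · (x − y) ≥ |x − y|³ / ( 2(1 + |x|²)(1 + |y|²) ), where · denotes the Euclidean inner product. -/
open scoped RealInnerProductSpace

/-- Pointwise lower bound of Lemma 3.2 for the localized virial function
`f(r) = r − arctan r`, `f'(r) = r²/(1+r²)`. -/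
theorem localized_virial_pointwise_bound (x y : EuclideanSpace ℝ (Fin 3)) :
    ⟪(‖x‖ / (1 + ‖x‖ ^ 2)) • x - (‖y‖ / (1 + ‖y‖ ^ 2)) • y, x - y⟫ ≥
      ‖x - y‖ ^ 3 / (2 * (1 + ‖x‖ ^ 2) * (1 + ‖y‖ ^ 2)) := by
  have hs : ⟪x, y⟫ = (‖x‖ ^ 2 + ‖y‖ ^ 2 - ‖x - y‖ ^ 2) / 2 := by
    have := norm_sub_sq_real x y
    linarith
  have hinner : ⟪(‖x‖ / (1 + ‖x‖ ^ 2)) • x - (‖y‖ / (1 + ‖y‖ ^ 2)) • y, x - y⟫ =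
      ‖x‖ / (1 + ‖x‖ ^ 2) * (‖x‖ ^ 2 - ⟪x, y⟫) + ‖y‖ / (1 + ‖y‖ ^ 2) * (‖y‖ ^ 2 - ⟪x, y⟫) := by
    simp only [inner_sub_left, inner_sub_right, real_inner_smul_left,
      real_inner_self_eq_norm_sq, real_inner_comm x y]
    ring
  have htri : ‖x - y‖ ≤ ‖x‖ + ‖y‖ := norm_sub_le x y
  have hrev : (‖x‖ - ‖y‖) ^ 2 ≤ ‖x - y‖ ^ 2 :=
    sq_le_sq.2 (by simpa using abs_norm_sub_norm_le x y)
  rw [hinner, hs, ge_iff_le]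
  have ha := norm_nonneg x
  have hb := norm_nonneg y
  generalize ‖x - y‖ = d at *
  generalize ‖x‖ = a at *
  generalize ‖y‖ = b at *
  have hid : a / (1 + a ^ 2) * (a ^ 2 - (a ^ 2 + b ^ 2 - d ^ 2) / 2) +
      b / (1 + b ^ 2) * (b ^ 2 - (a ^ 2 + b ^ 2 - d ^ 2) / 2) =
      ((a + b) * ((a - b) ^ 2 + d ^ 2) + a * b * (a + b) * (d ^ 2 - (a - b) ^ 2)) /
        (2 * (1 + a ^ 2) * (1 + b ^ 2)) := by
    field_simp
    ring
  rw [hid]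
  apply div_le_div_of_nonneg_right _ (by positivity)
  have h₁ : 0 ≤ a * b * (a + b) * (d ^ 2 - (a - b) ^ 2) :=
    mul_nonneg (by positivity) (sub_nonneg.2 hrev)
  have h₂ : 0 ≤ (a + b) * (a - b) ^ 2 := by positivity
  have h₃ : 0 ≤ (a + b - d) * d ^ 2 := mul_nonneg (sub_nonneg.2 htri) (sq_nonneg d)
  linarith
end

section
/- For all real numbers r, s with 0 < s < r and all real numbers a, b, the following integral identity holds: (1/2)·∫_{−1}^{1} ( r·a + s·b − θ(s·a + r·b) ) / (r² + s² − 2rsθ)^{3/2} dθ = a / r². -/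
/-- The explicit antiderivative of the integrand of the spherical average. -/
theorem hasDerivAt_radial_virial_primitive {r s θ : ℝ} (a b : ℝ) (hr : r ≠ 0) (hs : s ≠ 0)
    (hD : 0 < r ^ 2 + s ^ 2 - 2 * r * s * θ) :
    HasDerivAt
      (fun t : ℝ => (a * (r * t - s) / r ^ 2 + b * (s * t - r) / s ^ 2) /
        √(r ^ 2 + s ^ 2 - 2 * r * s * t))
      ((r * a + s * b - θ * (s * a + r * b)) /
        (r ^ 2 + s ^ 2 - 2 * r * s * θ) ^ ((3 : ℝ) / 2)) θ := by
  have hq : HasDerivAt (fun t : ℝ => r ^ 2 + s ^ 2 - 2 * r * s * t) (-(2 * r * s)) θ := by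
    simpa using ((hasDerivAt_id θ).const_mul (2 * r * s)).const_sub (r ^ 2 + s ^ 2)
  have hn : HasDerivAt (fun t : ℝ => a * (r * t - s) / r ^ 2 + b * (s * t - r) / s ^ 2)
      (a * r / r ^ 2 + b * s / s ^ 2) θ := by
    simpa using
      (((((hasDerivAt_id θ).const_mul r).sub_const s).const_mul a).div_const (r ^ 2)).fun_add
        (((((hasDerivAt_id θ).const_mul s).sub_const r).const_mul b).div_const (s ^ 2))
  have hpow : (r ^ 2 + s ^ 2 - 2 * r * s * θ) ^ ((3 : ℝ) / 2) =
      √(r ^ 2 + s ^ 2 - 2 * r * s * θ) ^ 3 := by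
    rw [Real.sqrt_eq_rpow, ← Real.rpow_mul_natCast hD.le]
    norm_num
  refine (hn.fun_div (hq.sqrt hD.ne') (Real.sqrt_pos.2 hD).ne').congr_deriv ?_
  rw [hpow]
  have hw := Real.sqrt_pos.2 hD
  have hw2 := Real.sq_sqrt hD.le
  generalize √(r ^ 2 + s ^ 2 - 2 * r * s * θ) = w at hw hw2 ⊢
  field_simp
  rw [hw2]
  ring

/-- Spherical-average identity for a general radial virial function. -/
theorem radial_virial_average (r s a b : ℝ) (hs : 0 < s) (hsr : s < r) :
    (1 / 2) * ∫ θ in (-1 : ℝ)..1,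
        (r * a + s * b - θ * (s * a + r * b)) /
          (r ^ 2 + s ^ 2 - 2 * r * s * θ) ^ ((3 : ℝ) / 2) = a / r ^ 2 := by
  have hr : 0 < r := hs.trans hsr
  have hD : ∀ θ ∈ Set.uIcc (-1 : ℝ) 1, 0 < r ^ 2 + s ^ 2 - 2 * r * s * θ := by
    intro θ hθ
    rw [Set.uIcc_of_le (by norm_num)] at hθ
    nlinarith [mul_nonneg (mul_pos hr hs).le (sub_nonneg.2 hθ.2), pow_pos (sub_pos.2 hsr) 2]
  rw [intervalIntegral.integral_eq_sub_of_hasDerivAt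
    (fun θ hθ => hasDerivAt_radial_virial_primitive a b hr.ne' hs.ne' (hD θ hθ))]
  · have h1 : √(r ^ 2 + s ^ 2 - 2 * r * s * 1) = r - s := by
      rw [show r ^ 2 + s ^ 2 - 2 * r * s * 1 = (r - s) ^ 2 by ring,
        Real.sqrt_sq (sub_pos.2 hsr).le]
    have h2 : √(r ^ 2 + s ^ 2 - 2 * r * s * (-1)) = r + s := by
      rw [show r ^ 2 + s ^ 2 - 2 * r * s * (-1) = (r + s) ^ 2 by ring,
        Real.sqrt_sq (add_pos hr hs).le]
    have hsub : r - s ≠ 0 := (sub_pos.2 hsr).ne'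
    have hadd : r + s ≠ 0 := (add_pos hr hs).ne'
    rw [h1, h2]
    field_simp
    ring
  · refine ContinuousOn.intervalIntegrable (ContinuousOn.div (by fun_prop) ?_ ?_)
    · exact ContinuousOn.rpow_const (by fun_prop) fun θ hθ => Or.inl (hD θ hθ).ne'
    · exact fun θ hθ => (Real.rpow_pos_of_pos (hD θ hθ) _).ne'
end

section
/- Generalized Hardy inequality: let d ≥ 1 and let β be any real number. Then for every smooth compactly supported function u : ℝ^d → ℂ whose support does not contain the origin, one has ∫_{ℝ^d} |x|^{β−2} |ω_x · ∇u(x)|² dx ≥ ((β + d − 4)² / 4) · ∫_{ℝ^d} |x|^{β−4} |u(x)|² dx, where ω_x = x/|x| and ω_x · ∇u(x) denotes the radial derivative (the inner product of ω_x with the gradient of u). -/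
open MeasureTheory Filter Topology Module

section WeightedHardy

variable {E F : Type*} [NormedAddCommGroup E] [InnerProductSpace ℝ E]
  [NormedAddCommGroup F] [InnerProductSpace ℝ F]

/-- Multiplying by a power of the norm preserves regularity for functions vanishing near `0`. -/
theorem ContDiff.norm_rpow_mul {n : WithTop ℕ∞} {h : E → ℝ} (hh : ContDiff ℝ n h)
    (h0 : h =ᶠ[𝓝 0] 0) (p : ℝ) : ContDiff ℝ n fun x ↦ ‖x‖ ^ p * h x := by
  rw [contDiff_iff_contDiffAt]
  intro x
  rcases eq_or_ne x 0 with rfl | hx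
  · refine (contDiffAt_const (c := (0 : ℝ))).congr_of_eventuallyEq ?_
    filter_upwards [h0] with y hy
    simp [hy]
  · exact ((contDiffAt_norm ℝ hx).rpow_const_of_ne (norm_ne_zero_iff.2 hx)).mul hh.contDiffAt

theorem Continuous.integrable_norm_rpow_mul [MeasurableSpace E] [BorelSpace E]
    {μ : Measure E} [IsFiniteMeasureOnCompacts μ] {h : E → ℝ} (hh : Continuous h)
    (hc : HasCompactSupport h) (h0 : h =ᶠ[𝓝 0] 0) (p : ℝ) :
    Integrable (fun x ↦ ‖x‖ ^ p * h x) μ :=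
  (ContDiff.norm_rpow_mul (contDiff_zero.2 hh) h0 p).continuous.integrable_of_hasCompactSupport
    hc.mul_left

/-- Integration by parts against the Euler vector field `x ↦ x`. -/
theorem integral_fderiv_apply_self [FiniteDimensional ℝ E] [MeasurableSpace E] [BorelSpace E]
    (μ : Measure E) [μ.IsAddHaarMeasure] {g : E → ℝ} (hg : ContDiff ℝ 1 g)
    (hc : HasCompactSupport g) :
    ∫ x, fderiv ℝ g x x ∂μ = -(finrank ℝ E : ℝ) * ∫ x, g x ∂μ := by
  let b := stdOrthonormalBasis ℝ E
  have hcont (i) : Continuous fun x ↦ fderiv ℝ g x (b i) :=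
    (hg.continuous_fderiv one_ne_zero).clm_apply continuous_const
  have hint (i) : Integrable (fun x ↦ inner ℝ (b i) x * fderiv ℝ g x (b i)) μ :=
    Continuous.integrable_of_hasCompactSupport (by have := hcont i; fun_prop)
      (hc.fderiv_apply ℝ (b i)).mul_left
  have hderiv (i) (x : E) : fderiv ℝ (fun y ↦ inner ℝ (b i) y) x (b i) = 1 := by
    change fderiv ℝ (innerSL ℝ (b i)) x (b i) = 1
    rw [ContinuousLinearMap.fderiv]
    simp
  have hparts (i) : ∫ x, inner ℝ (b i) x * fderiv ℝ g x (b i) ∂μ = -∫ x, g x ∂μ := by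
    rw [integral_mul_fderiv_eq_neg_fderiv_mul_of_integrable (f := fun x ↦ inner ℝ (b i) x)]
    · simp [hderiv]
    · simpa [hderiv] using hg.continuous.integrable_of_hasCompactSupport hc
    · exact hint i
    · exact Continuous.integrable_of_hasCompactSupport
        (by have := hg.continuous; fun_prop) hc.mul_left
    · intro x _
      exact (innerSL ℝ (b i)).differentiableAt
    · intro x _
      exact hg.differentiable one_ne_zero x
  have hsum (x : E) : fderiv ℝ g x x = ∑ i, inner ℝ (b i) x * fderiv ℝ g x (b i) := by
    simpa using congrArg (fderiv ℝ g x) (b.sum_repr' x).symm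
  simp_rw [hsum]
  rw [integral_finsetSum _ fun i _ ↦ hint i]
  simp [hparts]

theorem fderiv_norm_rpow_mul_norm_sq_apply_self {u : E → F} {x : E} (hx : x ≠ 0)
    (hu : DifferentiableAt ℝ u x) (p : ℝ) :
    fderiv ℝ (fun y ↦ ‖y‖ ^ p * ‖u y‖ ^ 2) x x =
      p * (‖x‖ ^ p * ‖u x‖ ^ 2) + 2 * (‖x‖ ^ p * inner ℝ (u x) (fderiv ℝ u x x)) := by
  have hn : ‖x‖ ≠ 0 := norm_ne_zero_iff.2 hx
  have hpow : HasFDerivAt (fun y : E ↦ ‖y‖ ^ p)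
      ((p * ‖x‖ ^ (p - 1)) • fderiv ℝ (fun y : E ↦ ‖y‖) x) x :=
    ((contDiffAt_norm ℝ hx (n := 1)).differentiableAt one_ne_zero).hasFDerivAt.rpow_const
      (Or.inl hn)
  have hnorm : fderiv ℝ (fun y : E ↦ ‖y‖) x x = ‖x‖ :=
    ((contDiffAt_norm ℝ hx (n := 1)).differentiableAt one_ne_zero).fderiv_norm_self
  rw [HasFDerivAt.fderiv (hpow.fun_mul hu.hasFDerivAt.norm_sq)]
  have : ‖x‖ ^ (p - 1) * ‖x‖ = ‖x‖ ^ p := by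
    rw [Real.rpow_sub_one hn, div_mul_cancel₀ _ hn]
  simp only [add_apply, smul_apply, hnorm,
    ContinuousLinearMap.comp_apply, innerSL_apply_apply, smul_eq_mul, nsmul_eq_mul, ← this]
  push_cast
  ring

/-- The Hardy inequality for the Euler operator `u ↦ (x ↦ fderiv ℝ u x x)` with weight `‖x‖ ^ p`. -/
theorem integral_norm_rpow_mul_norm_sq_le [FiniteDimensional ℝ E] [MeasurableSpace E]
    [BorelSpace E] (μ : Measure E) [μ.IsAddHaarMeasure] {u : E → F} (hu : ContDiff ℝ 1 u)
    (hc : HasCompactSupport u) (h0 : (0 : E) ∉ tsupport u) (p : ℝ) :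
    (p + finrank ℝ E) ^ 2 / 4 * ∫ x, ‖x‖ ^ p * ‖u x‖ ^ 2 ∂μ ≤
      ∫ x, ‖x‖ ^ p * ‖fderiv ℝ u x x‖ ^ 2 ∂μ := by
  have hu0 : u =ᶠ[𝓝 0] 0 := notMem_tsupport_iff_eventuallyEq.1 h0
  have hdu0 : fderiv ℝ u =ᶠ[𝓝 0] 0 := by simpa using hu0.fderiv
  have hcd : Continuous fun x ↦ fderiv ℝ u x x :=
    (hu.continuous_fderiv one_ne_zero).clm_apply continuous_id
  have hnsq0 : (fun x ↦ ‖u x‖ ^ 2) =ᶠ[𝓝 0] 0 := by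
    filter_upwards [hu0] with x hx
    simp [hx]
  have hnsqc : HasCompactSupport fun x ↦ ‖u x‖ ^ 2 := hc.mono fun x hx hux ↦ hx (by simp [hux])
  have hI : Integrable (fun x ↦ ‖x‖ ^ p * ‖u x‖ ^ 2) μ :=
    (hu.continuous.norm.pow 2).integrable_norm_rpow_mul hnsqc hnsq0 p
  have hJ : Integrable (fun x ↦ ‖x‖ ^ p * inner ℝ (u x) (fderiv ℝ u x x)) μ := by
    refine (hu.continuous.inner hcd).integrable_norm_rpow_mul
      (hc.mono fun x hx hux ↦ hx (by simp [hux])) ?_ p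
    filter_upwards [hu0] with x hx
    simp [hx]
  have hK : Integrable (fun x ↦ ‖x‖ ^ p * ‖fderiv ℝ u x x‖ ^ 2) μ := by
    refine (hcd.norm.pow 2).integrable_norm_rpow_mul
      ((hc.fderiv ℝ).mono fun x hx hux ↦ hx (by simp [hux])) ?_ p
    filter_upwards [hdu0] with x hx
    simp [hx]
  have hparts := integral_fderiv_apply_self μ
    (ContDiff.norm_rpow_mul (hu.norm_sq ℝ) hnsq0 p) hnsqc.mul_left
  have heuler (x : E) : fderiv ℝ (fun y ↦ ‖y‖ ^ p * ‖u y‖ ^ 2) x x =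
      p * (‖x‖ ^ p * ‖u x‖ ^ 2) + 2 * (‖x‖ ^ p * inner ℝ (u x) (fderiv ℝ u x x)) := by
    rcases eq_or_ne x 0 with rfl | hx
    · simp [image_eq_zero_of_notMem_tsupport h0]
    · exact fderiv_norm_rpow_mul_norm_sq_apply_self hx (hu.differentiable one_ne_zero x) p
  simp_rw [heuler] at hparts
  rw [integral_add (hI.const_mul _) (hJ.const_mul _), integral_const_mul,
    integral_const_mul] at hparts
  set c : ℝ := p + finrank ℝ E with hcdef
  have hnonneg : 0 ≤ ∫ x, ‖x‖ ^ p * ‖fderiv ℝ u x x‖ ^ 2 +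
      c * (‖x‖ ^ p * inner ℝ (u x) (fderiv ℝ u x x)) +
      c ^ 2 / 4 * (‖x‖ ^ p * ‖u x‖ ^ 2) ∂μ := by
    refine integral_nonneg fun x ↦ ?_
    have hsq : 0 ≤ ‖x‖ ^ p * ‖fderiv ℝ u x x + (c / 2) • u x‖ ^ 2 := by positivity
    rw [norm_add_sq_real, real_inner_smul_right, real_inner_comm, norm_smul, mul_pow,
      Real.norm_eq_abs, sq_abs] at hsq
    simp only [Pi.zero_apply]
    linarith
  have hKJ : Integrable (fun x ↦ ‖x‖ ^ p * ‖fderiv ℝ u x x‖ ^ 2 +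
      c * (‖x‖ ^ p * inner ℝ (u x) (fderiv ℝ u x x))) μ := hK.add (hJ.const_mul c)
  rw [integral_add hKJ (hI.const_mul _), integral_add hK (hJ.const_mul c),
    integral_const_mul, integral_const_mul] at hnonneg
  have hJI : ∫ x, ‖x‖ ^ p * inner ℝ (u x) (fderiv ℝ u x x) ∂μ =
      -(c / 2) * ∫ x, ‖x‖ ^ p * ‖u x‖ ^ 2 ∂μ := by
    rw [hcdef]
    linarith
  rw [hJI] at hnonneg
  linarith

end WeightedHardy


/-- Generalized Hardy inequality: for `u ∈ C_c^∞(ℝ^d \ {0})`,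
`∫ |x|^{β−2} |ω_x·∇u|² ≥ ((β+d−4)²/4) ∫ |x|^{β−4} |u|²`. -/
theorem generalized_hardy_inequality (d : ℕ) (hd : 1 ≤ d) (β : ℝ)
    (u : EuclideanSpace ℝ (Fin d) → ℂ)
    (hu : ContDiff ℝ (⊤ : ℕ∞) u) (hsupp : HasCompactSupport u)
    (h0 : (0 : EuclideanSpace ℝ (Fin d)) ∉ tsupport u) :
    ∫ x : EuclideanSpace ℝ (Fin d), ‖x‖ ^ (β - 2) * ‖fderiv ℝ u x (‖x‖⁻¹ • x)‖ ^ 2 ≥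
      ((β + d - 4) ^ 2 / 4) * ∫ x : EuclideanSpace ℝ (Fin d), ‖x‖ ^ (β - 4) * ‖u x‖ ^ 2 := by
  have hradial (x : EuclideanSpace ℝ (Fin d)) :
      ‖x‖ ^ (β - 2) * ‖fderiv ℝ u x (‖x‖⁻¹ • x)‖ ^ 2 =
        ‖x‖ ^ (β - 4) * ‖fderiv ℝ u x x‖ ^ 2 := by
    rcases eq_or_ne x 0 with rfl | hx
    · simp
    · have hn : ‖x‖ ≠ 0 := norm_ne_zero_iff.2 hx
      have hpow : ‖x‖ ^ (β - 2) = ‖x‖ ^ (β - 4) * ‖x‖ ^ 2 := by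
        rw [← Real.rpow_add_natCast hn]
        congr 1
        push_cast
        ring
      rw [map_smul, norm_smul, norm_inv, norm_norm, hpow]
      field_simp
  simp_rw [hradial]
  have h := integral_norm_rpow_mul_norm_sq_le volume (hu.of_le (by exact_mod_cast le_top))
    hsupp h0 (β - 4)
  rw [finrank_euclideanSpace_fin, sub_add_eq_add_sub] at h
  exact h
end

section
/- Estimate on −[Δ,[Δ,|x|^β]] (Lemma 2.2): let d ≥ 1 and β ≥ max(1, 4−d) be real, and set f(x) = |x|^β. Then for every smooth compactly supported u : ℝ^d → ℂ whose support does not contain the origin, − ∫_{ℝ^d} conj(u(x)) · ( Δ(Δ(f·u)) − 2Δ(f·Δu) + f·Δ(Δu) )(x) dx ≥ β(β + d − 4)(d − β) ∫_{ℝ^d} |x|^{β−4} |u(x)|² dx. In particular the left-hand side is nonnegative when max(1, 4−d) ≤ β ≤ d. -/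
open scoped ComplexConjugate

/-- The Laplacian on `ℝ^d` (sum of second partial derivatives). -/
noncomputable def laplacian {d : ℕ} {F : Type*} [NormedAddCommGroup F] [NormedSpace ℝ F]
    (u : EuclideanSpace ℝ (Fin d) → F) (x : EuclideanSpace ℝ (Fin d)) : F :=
  ∑ i, fderiv ℝ (fun y => fderiv ℝ u y (EuclideanSpace.single i 1)) x
    (EuclideanSpace.single i 1)

/-- The double commutator `[Δ,[Δ,f]]` applied to `u`:
`[Δ,[Δ,f]]u = Δ(Δ(f·u)) − 2Δ(f·Δu) + f·Δ(Δu)`. -/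
noncomputable def doubleCommutator {d : ℕ} (f : EuclideanSpace ℝ (Fin d) → ℝ)
    (u : EuclideanSpace ℝ (Fin d) → ℂ) (x : EuclideanSpace ℝ (Fin d)) : ℂ :=
  laplacian (laplacian (fun y => (f y : ℂ) * u y)) x
    - 2 * laplacian (fun y => (f y : ℂ) * laplacian u y) x
    + (f x : ℂ) * laplacian (laplacian u) x

open Topology MeasureTheory

section PartialDerivatives

variable {d : ℕ} {F : Type*} [NormedAddCommGroup F] [NormedSpace ℝ F]

/-- The `i`-th partial derivative on `ℝ^d`. -/
noncomputable def partialDeriv (i : Fin d) (u : EuclideanSpace ℝ (Fin d) → F)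
    (x : EuclideanSpace ℝ (Fin d)) : F :=
  fderiv ℝ u x (EuclideanSpace.single i 1)

theorem laplacian_eq_sum_partialDeriv (u : EuclideanSpace ℝ (Fin d) → F) :
    laplacian u = fun x => ∑ i, partialDeriv i (partialDeriv i u) x := rfl

theorem ContDiff.partialDeriv {u : EuclideanSpace ℝ (Fin d) → F}
    (hu : ContDiff ℝ (⊤ : ℕ∞) u) (i : Fin d) :
    ContDiff ℝ (⊤ : ℕ∞) (partialDeriv i u) :=
  (hu.fderiv_right (m := (⊤ : ℕ∞)) (by simp)).clm_apply contDiff_const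

theorem ContDiff.laplacian {u : EuclideanSpace ℝ (Fin d) → F}
    (hu : ContDiff ℝ (⊤ : ℕ∞) u) : ContDiff ℝ (⊤ : ℕ∞) (laplacian u) := by
  rw [laplacian_eq_sum_partialDeriv]
  exact ContDiff.sum fun i _ => (hu.partialDeriv i).partialDeriv i

theorem ContDiff.differentiableAt_of_smooth {u : EuclideanSpace ℝ (Fin d) → F}
    (hu : ContDiff ℝ (⊤ : ℕ∞) u) (x : EuclideanSpace ℝ (Fin d)) : DifferentiableAt ℝ u x :=
  hu.differentiable (by simp) x

theorem partialDeriv_comm {u : EuclideanSpace ℝ (Fin d) → F}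
    (hu : ContDiff ℝ (⊤ : ℕ∞) u) (i j : Fin d) :
    partialDeriv i (partialDeriv j u) = partialDeriv j (partialDeriv i u) := by
  have hd (x) : DifferentiableAt ℝ (fderiv ℝ u) x :=
    (hu.fderiv_right (m := (⊤ : ℕ∞)) (by simp)).differentiable (by simp) x
  have key (i j : Fin d) (x) : partialDeriv i (partialDeriv j u) x =
      fderiv ℝ (fderiv ℝ u) x (EuclideanSpace.single i 1) (EuclideanSpace.single j 1) := by
    change fderiv ℝ (fun y => fderiv ℝ u y (EuclideanSpace.single j 1)) x _ = _
    rw [fderiv_clm_apply (hd x) (differentiableAt_const _)]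
    simp
  funext x
  rw [key, key]
  exact (hu.contDiffAt.isSymmSndFDerivAt (by
    simpa using WithTop.coe_le_coe.2 (le_top : (2 : ℕ∞) ≤ ⊤))) _ _

theorem partialDeriv_add {u v : EuclideanSpace ℝ (Fin d) → F} (i : Fin d)
    (hu : ContDiff ℝ (⊤ : ℕ∞) u) (hv : ContDiff ℝ (⊤ : ℕ∞) v) :
    partialDeriv i (fun x => u x + v x) = fun x => partialDeriv i u x + partialDeriv i v x := by
  funext x
  simp [partialDeriv,
    fderiv_fun_add (hu.differentiableAt_of_smooth x) (hv.differentiableAt_of_smooth x)]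

theorem partialDeriv_sum {ι : Type*} (s : Finset ι) {u : ι → EuclideanSpace ℝ (Fin d) → F}
    (i : Fin d) (hu : ∀ k, ContDiff ℝ (⊤ : ℕ∞) (u k)) :
    partialDeriv i (fun x => ∑ k ∈ s, u k x) = fun x => ∑ k ∈ s, partialDeriv i (u k) x := by
  funext x
  simp [partialDeriv, fderiv_fun_sum fun k _ => (hu k).differentiableAt_of_smooth x]

theorem partialDeriv_mul {A : Type*} [NormedCommRing A] [NormedAlgebra ℝ A]
    {u v : EuclideanSpace ℝ (Fin d) → A} (i : Fin d)
    (hu : ContDiff ℝ (⊤ : ℕ∞) u) (hv : ContDiff ℝ (⊤ : ℕ∞) v) :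
    partialDeriv i (fun x => u x * v x) =
      fun x => partialDeriv i u x * v x + u x * partialDeriv i v x := by
  funext x
  simp [partialDeriv,
    fderiv_fun_mul (hu.differentiableAt_of_smooth x) (hv.differentiableAt_of_smooth x)]
  ring

theorem Filter.EventuallyEq.partialDeriv {u v : EuclideanSpace ℝ (Fin d) → F}
    {x : EuclideanSpace ℝ (Fin d)} (h : u =ᶠ[𝓝 x] v) (i : Fin d) :
    partialDeriv i u =ᶠ[𝓝 x] partialDeriv i v :=
  (h.fderiv (𝕜 := ℝ)).mono fun y hy => by simp only [_root_.partialDeriv, hy]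

theorem Filter.EventuallyEq.laplacian {u v : EuclideanSpace ℝ (Fin d) → F}
    {x : EuclideanSpace ℝ (Fin d)} (h : u =ᶠ[𝓝 x] v) :
    laplacian u =ᶠ[𝓝 x] laplacian v := by
  have h' := Filter.eventually_all.2 fun i => (h.partialDeriv i).partialDeriv i
  filter_upwards [h'] with y hy
  simp only [laplacian_eq_sum_partialDeriv, hy]

theorem partialDeriv_eq_zero_of_notMem_tsupport {u : EuclideanSpace ℝ (Fin d) → F}
    {x : EuclideanSpace ℝ (Fin d)} (hx : x ∉ tsupport u) (i : Fin d) :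
    partialDeriv i u x = 0 := by
  have := image_eq_zero_of_notMem_tsupport fun h => hx (tsupport_fderiv_subset ℝ (f := u) h)
  simp [partialDeriv, this]

theorem HasCompactSupport.partialDeriv {u : EuclideanSpace ℝ (Fin d) → F}
    (hu : HasCompactSupport u) (i : Fin d) : HasCompactSupport (partialDeriv i u) :=
  hu.fderiv_apply ℝ _

theorem partialDeriv_ofReal {f : EuclideanSpace ℝ (Fin d) → ℝ}
    (hf : ContDiff ℝ (⊤ : ℕ∞) f) (i : Fin d) :
    partialDeriv i (fun x => (f x : ℂ)) = fun x => ((partialDeriv i f x : ℝ) : ℂ) := by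
  funext x
  have h := (Complex.ofRealCLM.hasFDerivAt (x := f x)).comp x
    (hf.differentiableAt_of_smooth x).hasFDerivAt
  have h' : fderiv ℝ (fun x => (f x : ℂ)) x = Complex.ofRealCLM.comp (fderiv ℝ f x) := h.fderiv
  simp [partialDeriv, h']

theorem partialDeriv_conj {u : EuclideanSpace ℝ (Fin d) → ℂ}
    (hu : ContDiff ℝ (⊤ : ℕ∞) u) (i : Fin d) :
    partialDeriv i (fun x => conj (u x)) = fun x => conj (partialDeriv i u x) := by
  funext x
  have h := (Complex.conjCLE.toContinuousLinearMap.hasFDerivAt (x := u x)).comp x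
    (hu.differentiableAt_of_smooth x).hasFDerivAt
  have h' : fderiv ℝ (fun x => conj (u x)) x =
      Complex.conjCLE.toContinuousLinearMap.comp (fderiv ℝ u x) := h.fderiv
  simp [partialDeriv, h']

theorem partialDeriv_norm_sq {u : EuclideanSpace ℝ (Fin d) → ℂ}
    (hu : ContDiff ℝ (⊤ : ℕ∞) u) (i : Fin d) (x : EuclideanSpace ℝ (Fin d)) :
    partialDeriv i (fun x => ‖u x‖ ^ 2) x = 2 * (conj (u x) * partialDeriv i u x).re := by
  have h := (hu.differentiableAt_of_smooth x).hasFDerivAt.norm_sq.fderiv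
  simp [partialDeriv, h, Complex.inner]
  ring

theorem partialDeriv_coord (i j : Fin d) (x : EuclideanSpace ℝ (Fin d)) :
    partialDeriv i (fun y : EuclideanSpace ℝ (Fin d) => y j) x = if i = j then 1 else 0 := by
  have h : fderiv ℝ (fun y : EuclideanSpace ℝ (Fin d) => y j) x =
      EuclideanSpace.proj (𝕜 := ℝ) j := (EuclideanSpace.proj (𝕜 := ℝ) j).hasFDerivAt.fderiv
  simp [partialDeriv, h, eq_comm]

theorem integral_mul_partialDeriv {𝕜 : Type*} [NormedField 𝕜] [NormedAlgebra ℝ 𝕜]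
    {f g : EuclideanSpace ℝ (Fin d) → 𝕜}
    (hf : ContDiff ℝ (⊤ : ℕ∞) f) (hg : ContDiff ℝ (⊤ : ℕ∞) g)
    (h : HasCompactSupport f ∨ HasCompactSupport g) (i : Fin d) :
    ∫ x, f x * partialDeriv i g x = - ∫ x, partialDeriv i f x * g x := by
  refine integral_mul_fderiv_eq_neg_fderiv_mul_of_integrable ?_ ?_ ?_
    (fun x _ => hf.differentiableAt_of_smooth x) (fun x _ => hg.differentiableAt_of_smooth x)
  · refine ((hf.partialDeriv i).continuous.mul hg.continuous).integrable_of_hasCompactSupport ?_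
    exact h.elim (fun h => (h.partialDeriv i).mul_right) fun h => h.mul_left
  · refine (hf.continuous.mul (hg.partialDeriv i).continuous).integrable_of_hasCompactSupport ?_
    exact h.elim (fun h => h.mul_right) fun h => (h.partialDeriv i).mul_left
  · refine (hf.continuous.mul hg.continuous).integrable_of_hasCompactSupport ?_
    exact h.elim (fun h => h.mul_right) fun h => h.mul_left

theorem laplacian_mul {A : Type*} [NormedCommRing A] [NormedAlgebra ℝ A]
    {f u : EuclideanSpace ℝ (Fin d) → A}
    (hf : ContDiff ℝ (⊤ : ℕ∞) f) (hu : ContDiff ℝ (⊤ : ℕ∞) u) :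
    laplacian (fun x => f x * u x) = fun x => laplacian f x * u x +
      2 * ∑ i, partialDeriv i f x * partialDeriv i u x + f x * laplacian u x := by
  funext x
  simp only [laplacian_eq_sum_partialDeriv, Finset.sum_mul, Finset.mul_sum,
    ← Finset.sum_add_distrib]
  refine Finset.sum_congr rfl fun i _ => ?_
  rw [partialDeriv_mul i hf hu,
    partialDeriv_add i ((hf.partialDeriv i).mul hu) (hf.mul (hu.partialDeriv i)),
    partialDeriv_mul i (hf.partialDeriv i) hu, partialDeriv_mul i hf (hu.partialDeriv i)]
  ring

theorem laplacian_add {u v : EuclideanSpace ℝ (Fin d) → F}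
    (hu : ContDiff ℝ (⊤ : ℕ∞) u) (hv : ContDiff ℝ (⊤ : ℕ∞) v) :
    laplacian (fun x => u x + v x) = fun x => laplacian u x + laplacian v x := by
  funext x
  simp only [laplacian_eq_sum_partialDeriv, ← Finset.sum_add_distrib]
  refine Finset.sum_congr rfl fun i _ => ?_
  rw [partialDeriv_add i hu hv, partialDeriv_add i (hu.partialDeriv i) (hv.partialDeriv i)]

theorem laplacian_sum {ι : Type*} (s : Finset ι) {u : ι → EuclideanSpace ℝ (Fin d) → F}
    (hu : ∀ k, ContDiff ℝ (⊤ : ℕ∞) (u k)) :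
    laplacian (fun x => ∑ k ∈ s, u k x) = fun x => ∑ k ∈ s, laplacian (u k) x := by
  funext x
  simp only [laplacian_eq_sum_partialDeriv]
  rw [Finset.sum_comm]
  refine Finset.sum_congr rfl fun i _ => ?_
  rw [partialDeriv_sum s i hu, partialDeriv_sum s i fun k => (hu k).partialDeriv i]

theorem partialDeriv_laplacian {u : EuclideanSpace ℝ (Fin d) → F}
    (hu : ContDiff ℝ (⊤ : ℕ∞) u) (i : Fin d) :
    partialDeriv i (laplacian u) = laplacian (partialDeriv i u) := by
  simp only [laplacian_eq_sum_partialDeriv]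
  rw [partialDeriv_sum _ i fun k => (hu.partialDeriv k).partialDeriv k]
  funext x
  refine Finset.sum_congr rfl fun k _ => ?_
  rw [partialDeriv_comm (hu.partialDeriv k) i k, partialDeriv_comm hu i k]

/-- The double commutator with a smooth function, in divergence form:
`[Δ,[Δ,f]]u = (Δ²f) u + 4 ∑ ∂ᵢ((∂ᵢ∂ⱼf) ∂ⱼu)`. -/
theorem doubleCommutator_eq_divergence {f : EuclideanSpace ℝ (Fin d) → ℝ}
    {u : EuclideanSpace ℝ (Fin d) → ℂ}
    (hf : ContDiff ℝ (⊤ : ℕ∞) f) (hu : ContDiff ℝ (⊤ : ℕ∞) u) (x : EuclideanSpace ℝ (Fin d)) :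
    doubleCommutator f u x = ((laplacian (laplacian f) x : ℝ) : ℂ) * u x +
      4 * ∑ j, ∑ i, partialDeriv i
        (fun y => ((partialDeriv i (partialDeriv j f) y : ℝ) : ℂ) * partialDeriv j u y) x := by
  have ofReal_smooth {h : EuclideanSpace ℝ (Fin d) → ℝ} (hh : ContDiff ℝ (⊤ : ℕ∞) h) :
      ContDiff ℝ (⊤ : ℕ∞) fun x => (h x : ℂ) := Complex.ofRealCLM.contDiff.comp hh
  have laplacian_ofReal {h : EuclideanSpace ℝ (Fin d) → ℝ} (hh : ContDiff ℝ (⊤ : ℕ∞) h) :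
      laplacian (fun x => (h x : ℂ)) = fun x => ((laplacian h x : ℝ) : ℂ) := by
    simp only [laplacian_eq_sum_partialDeriv, partialDeriv_ofReal hh,
      partialDeriv_ofReal (hh.partialDeriv _), Complex.ofReal_sum]
  have laplacian_two_mul {v : EuclideanSpace ℝ (Fin d) → ℂ} (hv : ContDiff ℝ (⊤ : ℕ∞) v) :
      laplacian (fun x => 2 * v x) = fun x => 2 * laplacian v x := by
    simp only [two_mul, laplacian_add hv hv]
  rw [← congrFun (laplacian_ofReal hf.laplacian) x, ← laplacian_ofReal hf]
  have hFij (i j y) : ((partialDeriv i (partialDeriv j f) y : ℝ) : ℂ) =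
      partialDeriv i (partialDeriv j fun x => (f x : ℂ)) y := by
    rw [partialDeriv_ofReal hf, partialDeriv_ofReal (hf.partialDeriv j)]
  simp only [hFij]
  unfold doubleCommutator
  have hF := ofReal_smooth hf
  generalize hFdef : (fun x => (f x : ℂ)) = F at *
  have hFx (y) : (f y : ℂ) = F y := congrFun hFdef y
  simp only [hFx]
  have hj (j i) := (hF.partialDeriv j).partialDeriv i
  rw [laplacian_mul hF hu, laplacian_mul hF hu.laplacian]
  have h1 := hF.laplacian.mul hu
  have h2 (i) := (hF.partialDeriv i).mul (hu.partialDeriv i)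
  have h3 := contDiff_const (c := (2 : ℂ)).mul (ContDiff.sum fun i (_ : i ∈ Finset.univ) => h2 i)
  rw [laplacian_add (h1.add h3) (hF.mul hu.laplacian), laplacian_add h1 h3,
    laplacian_two_mul (ContDiff.sum fun i _ => h2 i), laplacian_sum _ h2,
    laplacian_mul hF.laplacian hu, laplacian_mul hF hu.laplacian]
  have h4 (i) := laplacian_mul (hF.partialDeriv i) (hu.partialDeriv i)
  have h5 (i j) := partialDeriv_mul i (hj j i) (hu.partialDeriv j)
  simp only [h4, h5, partialDeriv_laplacian hF, partialDeriv_laplacian hu,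
    Finset.sum_add_distrib, Finset.mul_sum]
  have h6 : ∑ j, ∑ i, partialDeriv i (partialDeriv i (partialDeriv j F)) x * partialDeriv j u x
      = ∑ j, laplacian (partialDeriv j F) x * partialDeriv j u x := by
    simp only [laplacian_eq_sum_partialDeriv, Finset.sum_mul]
  simp only [← Finset.mul_sum, h6]
  ring

end PartialDerivatives

section QuadraticForm

variable {d : ℕ}

/-- The quadratic form of `[Δ,[Δ,f]]` for smooth `f`, after integrating by parts. -/
theorem re_integral_conj_mul_doubleCommutator {f : EuclideanSpace ℝ (Fin d) → ℝ}
    {u : EuclideanSpace ℝ (Fin d) → ℂ} (hf : ContDiff ℝ (⊤ : ℕ∞) f)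
    (hu : ContDiff ℝ (⊤ : ℕ∞) u) (hsupp : HasCompactSupport u) :
    (∫ x, conj (u x) * doubleCommutator f u x).re =
      ∫ x, (laplacian (laplacian f) x * ‖u x‖ ^ 2 - 4 * ∑ j, ∑ i,
        partialDeriv i (partialDeriv j f) x *
          (conj (partialDeriv i u x) * partialDeriv j u x).re) := by
  set W : Fin d → Fin d → EuclideanSpace ℝ (Fin d) → ℂ := fun j i y =>
    ((partialDeriv i (partialDeriv j f) y : ℝ) : ℂ) * partialDeriv j u y with hW
  have hWs (j i) : ContDiff ℝ (⊤ : ℕ∞) (W j i) :=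
    (Complex.ofRealCLM.contDiff.comp ((hf.partialDeriv j).partialDeriv i)).mul (hu.partialDeriv j)
  have hcu : ContDiff ℝ (⊤ : ℕ∞) fun x => conj (u x) :=
    Complex.conjCLE.toContinuousLinearMap.contDiff.comp hu
  have hcs : HasCompactSupport fun x => conj (u x) := hsupp.comp_left (map_zero _)
  have hL : Continuous (laplacian (laplacian f)) := hf.laplacian.laplacian.continuous
  have i1 : Integrable fun x => conj (u x) * (((laplacian (laplacian f) x : ℝ) : ℂ) * u x) :=
    (hcu.continuous.mul ((Complex.continuous_ofReal.comp hL).mul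
      hu.continuous)).integrable_of_hasCompactSupport hcs.mul_right
  have i2 (j i) : Integrable fun x => conj (u x) * partialDeriv i (W j i) x :=
    (hcu.continuous.mul ((hWs j i).partialDeriv i).continuous).integrable_of_hasCompactSupport
      hcs.mul_right
  have i3 (j i) : Integrable fun x => partialDeriv i (fun x => conj (u x)) x * W j i x :=
    ((hcu.partialDeriv i).continuous.mul (hWs j i).continuous).integrable_of_hasCompactSupport
      (hcs.partialDeriv i).mul_right
  have e : ∫ x, conj (u x) * doubleCommutator f u x =
      ∫ x, (conj (u x) * (((laplacian (laplacian f) x : ℝ) : ℂ) * u x) -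
        4 * ∑ j, ∑ i, partialDeriv i (fun x => conj (u x)) x * W j i x) := by
    have : ∀ x, conj (u x) * doubleCommutator f u x =
        conj (u x) * (((laplacian (laplacian f) x : ℝ) : ℂ) * u x) +
          4 * ∑ j, ∑ i, conj (u x) * partialDeriv i (W j i) x := fun x => by
      rw [doubleCommutator_eq_divergence hf hu]
      simp only [← Finset.mul_sum]
      ring
    simp_rw [this]
    have s2 : ∀ j, Integrable fun x => ∑ i, conj (u x) * partialDeriv i (W j i) x := fun j =>
      integrable_finsetSum _ fun i _ => i2 j i
    have s3 : ∀ j, Integrable fun x =>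
        ∑ i, partialDeriv i (fun x => conj (u x)) x * W j i x := fun j =>
      integrable_finsetSum _ fun i _ => i3 j i
    rw [integral_add i1 ((integrable_finsetSum _ fun j _ => s2 j).const_mul 4),
      integral_sub i1 ((integrable_finsetSum _ fun j _ => s3 j).const_mul 4),
      integral_const_mul, integral_const_mul, integral_finsetSum _ fun j _ => s2 j,
      integral_finsetSum _ fun j _ => s3 j]
    simp_rw [integral_finsetSum _ fun i _ => i2 _ i, integral_finsetSum _ fun i _ => i3 _ i,
      integral_mul_partialDeriv hcu (hWs _ _) (Or.inl hcs), Finset.sum_neg_distrib]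
    ring
  have hint : Integrable fun x =>
      conj (u x) * (((laplacian (laplacian f) x : ℝ) : ℂ) * u x) -
        4 * ∑ j, ∑ i, partialDeriv i (fun x => conj (u x)) x * W j i x :=
    i1.sub ((integrable_finsetSum _ fun j _ => integrable_finsetSum _ fun i _ => i3 j i).const_mul 4)
  rw [e]
  refine (integral_re hint).symm.trans (integral_congr_ae (.of_forall fun x => ?_))
  have h1 : conj (u x) * (((laplacian (laplacian f) x : ℝ) : ℂ) * u x) =
      ((laplacian (laplacian f) x * ‖u x‖ ^ 2 : ℝ) : ℂ) := by
    push_cast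
    rw [← Complex.conj_mul']
    ring
  have h2 (i j) : partialDeriv i (fun x => conj (u x)) x * W j i x =
      ((partialDeriv i (partialDeriv j f) x : ℝ) : ℂ) *
        (conj (partialDeriv i u x) * partialDeriv j u x) := by
    rw [partialDeriv_conj hu, hW]
    ring
  have h4 (z : ℂ) : (4 * z).re = 4 * z.re := by simp
  simp only [RCLike.re_eq_complex_re, h1, h2, Complex.sub_re, Complex.ofReal_re, h4,
    Complex.re_sum, Complex.re_ofReal_mul]

/-- Weighted divergence identity behind Hardy's inequality. -/
theorem integral_weighted_radial_partialDeriv {p v : EuclideanSpace ℝ (Fin d) → ℝ}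
    (hp : ContDiff ℝ (⊤ : ℕ∞) p) (hv : ContDiff ℝ (⊤ : ℕ∞) v) (hsupp : HasCompactSupport v) :
    ∫ x, ∑ i, x i * p x * partialDeriv i v x =
      - ∫ x, (d * p x + ∑ i, x i * partialDeriv i p x) * v x := by
  have hc (i : Fin d) : ContDiff ℝ (⊤ : ℕ∞) fun x : EuclideanSpace ℝ (Fin d) => x i :=
    (EuclideanSpace.proj (𝕜 := ℝ) i).contDiff
  have hcp (i) := (hc i).mul hp
  have i1 (i) : Integrable fun x : EuclideanSpace ℝ (Fin d) => x i * p x * partialDeriv i v x :=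
    ((hcp i).continuous.mul (hv.partialDeriv i).continuous).integrable_of_hasCompactSupport
      (hsupp.partialDeriv i).mul_left
  have i2 (i) : Integrable fun x => partialDeriv i (fun x => x i * p x) x * v x :=
    (((hcp i).partialDeriv i).continuous.mul hv.continuous).integrable_of_hasCompactSupport
      hsupp.mul_left
  rw [integral_finsetSum _ fun i _ => i1 i]
  simp_rw [integral_mul_partialDeriv (hcp _) hv (Or.inr hsupp), Finset.sum_neg_distrib]
  rw [← integral_finsetSum _ fun i _ => i2 i]
  congr 2
  funext x
  simp only [partialDeriv_mul _ (hc _) hp, partialDeriv_coord, if_true, ← Finset.sum_mul,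
    Finset.sum_add_distrib]
  simp

end QuadraticForm

section NormPower

variable {d : ℕ}

theorem contDiffAt_norm_rpow {x : EuclideanSpace ℝ (Fin d)} (hx : x ≠ 0) (γ : ℝ) :
    ContDiffAt ℝ (⊤ : ℕ∞) (fun y : EuclideanSpace ℝ (Fin d) => ‖y‖ ^ γ) x :=
  (contDiffAt_norm ℝ hx).rpow_const_of_ne (norm_ne_zero_iff.2 hx)

/-- Away from the origin every power of the norm agrees with a globally smooth function. -/
theorem exists_contDiff_eventuallyEq_norm_rpow {δ : ℝ} (hδ : 0 < δ) (γ : ℝ) :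
    ∃ g : EuclideanSpace ℝ (Fin d) → ℝ, ContDiff ℝ (⊤ : ℕ∞) g ∧
      ∀ x, δ < ‖x‖ → g =ᶠ[𝓝 x] fun y => ‖y‖ ^ γ := by
  let χ : ContDiffBump (0 : EuclideanSpace ℝ (Fin d)) := ⟨δ / 2, δ, by positivity, by linarith⟩
  refine ⟨fun x => (1 - χ x) * ‖x‖ ^ γ, contDiff_iff_contDiffAt.2 fun x => ?_, fun x hx => ?_⟩
  · by_cases hx : x = 0
    · refine (contDiffAt_const (c := (0 : ℝ))).congr_of_eventuallyEq ?_
      rw [hx]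
      filter_upwards [χ.eventuallyEq_one] with y hy
      simp [hy]
    · exact (contDiffAt_const.sub χ.contDiffAt).mul (contDiffAt_norm_rpow hx γ)
  · filter_upwards [continuous_norm.continuousAt.eventually (lt_mem_nhds hx)] with y hy
    rw [χ.zero_of_le_dist (by simpa using hy.le)]
    ring

theorem partialDeriv_norm_rpow {x : EuclideanSpace ℝ (Fin d)} (hx : x ≠ 0) (γ : ℝ) (i : Fin d) :
    partialDeriv i (fun y : EuclideanSpace ℝ (Fin d) => ‖y‖ ^ γ) x =
      γ * (‖x‖ ^ (γ - 2) * x i) := by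
  have hpos : 0 < ‖x‖ := norm_pos_iff.2 hx
  have hsq := (hasStrictFDerivAt_norm_sq x).hasFDerivAt.rpow_const (p := γ / 2)
    (Or.inl (by positivity))
  have hfun : (fun y : EuclideanSpace ℝ (Fin d) => (‖y‖ ^ 2) ^ (γ / 2)) = fun y => ‖y‖ ^ γ := by
    funext y
    rw [← Real.rpow_natCast_mul (norm_nonneg y)]
    congr 1
    push_cast
    ring
  rw [hfun] at hsq
  have hexp : (‖x‖ ^ 2) ^ (γ / 2 - 1) = ‖x‖ ^ (γ - 2) := by
    rw [← Real.rpow_natCast_mul (norm_nonneg x)]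
    congr 1
    push_cast
    ring
  simp [partialDeriv, hsq.fderiv, hexp, EuclideanSpace.inner_single_right]
  ring

theorem partialDeriv_partialDeriv_norm_rpow {x : EuclideanSpace ℝ (Fin d)} (hx : x ≠ 0) (γ : ℝ)
    (i j : Fin d) :
    partialDeriv i (partialDeriv j fun y : EuclideanSpace ℝ (Fin d) => ‖y‖ ^ γ) x =
      γ * ((γ - 2) * ‖x‖ ^ (γ - 4) * x i * x j + if i = j then ‖x‖ ^ (γ - 2) else 0) := by
  have hev : (partialDeriv j fun y : EuclideanSpace ℝ (Fin d) => ‖y‖ ^ γ) =ᶠ[𝓝 x]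
      fun y => γ * (‖y‖ ^ (γ - 2) * y j) := by
    filter_upwards [isOpen_ne.mem_nhds hx] with y hy using partialDeriv_norm_rpow hy γ j
  rw [(hev.partialDeriv i).eq_of_nhds]
  have h1 : DifferentiableAt ℝ (fun y : EuclideanSpace ℝ (Fin d) => ‖y‖ ^ (γ - 2)) x :=
    (contDiffAt_norm_rpow hx _).differentiableAt (by simp)
  have h2 : DifferentiableAt ℝ (fun y : EuclideanSpace ℝ (Fin d) => y j) x :=
    (EuclideanSpace.proj (𝕜 := ℝ) j).differentiableAt
  have e1 := partialDeriv_norm_rpow hx (γ - 2) i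
  have e2 := partialDeriv_coord i j x
  unfold partialDeriv at e1 e2 ⊢
  rw [fderiv_const_mul (h1.fun_mul h2), fderiv_fun_mul h1 h2]
  simp only [smul_eq_mul, add_apply, smul_apply, e1, e2]
  rw [show γ - 2 - 2 = γ - 4 by ring]
  split_ifs <;> ring

theorem laplacian_norm_rpow {x : EuclideanSpace ℝ (Fin d)} (hx : x ≠ 0) (γ : ℝ) :
    laplacian (fun y : EuclideanSpace ℝ (Fin d) => ‖y‖ ^ γ) x =
      γ * (γ + d - 2) * ‖x‖ ^ (γ - 2) := by
  have hsum : ‖x‖ ^ (γ - 4) * ∑ i, x i * x i = ‖x‖ ^ (γ - 2) := by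
    have : ∑ i, x i * x i = ‖x‖ ^ (2 : ℝ) := by
      rw [Real.rpow_two, EuclideanSpace.real_norm_sq_eq]
      exact Finset.sum_congr rfl fun i _ => (sq _).symm
    rw [this, ← Real.rpow_add (norm_pos_iff.2 hx)]
    congr 1
    ring
  simp only [laplacian_eq_sum_partialDeriv, partialDeriv_partialDeriv_norm_rpow hx, if_true,
    ← Finset.mul_sum, Finset.sum_add_distrib, mul_assoc, hsum]
  simp only [Finset.sum_const, Finset.card_univ, Fintype.card_fin, nsmul_eq_mul]
  ring

theorem laplacian_const_mul (c : ℝ) (v : EuclideanSpace ℝ (Fin d) → ℝ) :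
    laplacian (fun y => c * v y) = fun y => c * laplacian v y := by
  have h (i : Fin d) (v : EuclideanSpace ℝ (Fin d) → ℝ) :
      partialDeriv i (fun y => c * v y) = fun y => c * partialDeriv i v y := by
    funext x
    have e := congrFun (fderiv_const_smul_field (𝕜 := ℝ) c (f := v)) x
    exact congrArg (· (EuclideanSpace.single i 1)) e
  simp only [laplacian_eq_sum_partialDeriv, h, Finset.mul_sum]

theorem laplacian_laplacian_norm_rpow {x : EuclideanSpace ℝ (Fin d)} (hx : x ≠ 0) (γ : ℝ) :
    laplacian (laplacian fun y : EuclideanSpace ℝ (Fin d) => ‖y‖ ^ γ) x =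
      γ * (γ + d - 2) * (γ - 2) * (γ + d - 4) * ‖x‖ ^ (γ - 4) := by
  have hev : (laplacian fun y : EuclideanSpace ℝ (Fin d) => ‖y‖ ^ γ) =ᶠ[𝓝 x]
      fun y => γ * (γ + d - 2) * ‖y‖ ^ (γ - 2) := by
    filter_upwards [isOpen_ne.mem_nhds hx] with y hy using laplacian_norm_rpow hy γ
  rw [hev.laplacian.eq_of_nhds, laplacian_const_mul]
  simp only [laplacian_norm_rpow hx]
  rw [show γ - 2 - 2 = γ - 4 by ring]
  ring

end NormPower

section Pointwise

variable {d : ℕ}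

theorem norm_sum_ofReal_mul_sq_le (x : EuclideanSpace ℝ (Fin d)) (z : Fin d → ℂ) :
    ‖∑ i, (x i : ℂ) * z i‖ ^ 2 ≤ ‖x‖ ^ 2 * ∑ i, ‖z i‖ ^ 2 := by
  calc ‖∑ i, (x i : ℂ) * z i‖ ^ 2 ≤ (∑ i, ‖x i‖ * ‖z i‖) ^ 2 := by
        gcongr
        refine (norm_sum_le _ _).trans_eq (Finset.sum_congr rfl fun i _ => ?_)
        rw [norm_mul, Complex.norm_real]
    _ ≤ (∑ i, ‖x i‖ ^ 2) * ∑ i, ‖z i‖ ^ 2 := Finset.sum_mul_sq_le_sq_mul_sq _ _ _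
    _ = ‖x‖ ^ 2 * ∑ i, ‖z i‖ ^ 2 := by rw [EuclideanSpace.norm_sq_eq]

/-- The Hessian form of `‖x‖ ^ β` dominates its radial part. -/
theorem hessian_norm_rpow_ge {β : ℝ} (hβ : 0 ≤ β) {x : EuclideanSpace ℝ (Fin d)} (hx : x ≠ 0)
    (z : Fin d → ℂ) :
    β * (β - 1) * ‖x‖ ^ (β - 4) * ‖∑ i, (x i : ℂ) * z i‖ ^ 2 ≤
      ∑ j, ∑ i, partialDeriv i (partialDeriv j fun y : EuclideanSpace ℝ (Fin d) => ‖y‖ ^ β) x *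
        (conj (z i) * z j).re := by
  have hq : ‖x‖ ^ (β - 2) = ‖x‖ ^ (β - 4) * ‖x‖ ^ 2 := by
    rw [← Real.rpow_two, ← Real.rpow_add (norm_pos_iff.2 hx)]
    congr 1
    ring
  have hS : ‖∑ i, (x i : ℂ) * z i‖ ^ 2 = ∑ j, ∑ i, x i * x j * (conj (z i) * z j).re := by
    have h1 : ((‖∑ i, (x i : ℂ) * z i‖ ^ 2 : ℝ) : ℂ) =
        ∑ j, ∑ i, ((x i * x j : ℝ) : ℂ) * (conj (z i) * z j) := by
      push_cast
      rw [← Complex.conj_mul', map_sum, Finset.sum_mul_sum, Finset.sum_comm]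
      refine Finset.sum_congr rfl fun j _ => Finset.sum_congr rfl fun i _ => ?_
      rw [map_mul, Complex.conj_ofReal]
      ring
    have h2 := congrArg Complex.re h1
    simpa only [Complex.ofReal_re, Complex.re_sum, Complex.re_ofReal_mul] using h2
  have hz : ∀ j, (conj (z j) * z j).re = ‖z j‖ ^ 2 := fun j => by
    rw [Complex.conj_mul', ← Complex.ofReal_pow, Complex.ofReal_re]
  have hform : ∑ j, ∑ i,
      partialDeriv i (partialDeriv j fun y : EuclideanSpace ℝ (Fin d) => ‖y‖ ^ β) x *
        (conj (z i) * z j).re = β * (β - 2) * ‖x‖ ^ (β - 4) * ‖∑ i, (x i : ℂ) * z i‖ ^ 2 +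
          β * ‖x‖ ^ (β - 4) * (‖x‖ ^ 2 * ∑ i, ‖z i‖ ^ 2) := by
    simp only [hS, Finset.mul_sum, ← Finset.sum_add_distrib]
    refine Finset.sum_congr rfl fun j _ => ?_
    simp only [partialDeriv_partialDeriv_norm_rpow hx, mul_add, add_mul, Finset.sum_add_distrib,
      mul_ite, ite_mul, mul_zero, zero_mul, Finset.sum_ite_eq', Finset.mem_univ, if_true, hz, hq]
    congr 1
    · exact Finset.sum_congr rfl fun i _ => by ring
    · ring
  rw [hform]
  have hcs := mul_le_mul_of_nonneg_left (norm_sum_ofReal_mul_sq_le x z)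
    (mul_nonneg hβ (Real.rpow_nonneg (norm_nonneg x) (β - 4)))
  linarith

theorem neg_two_mul_re_sub_sq_le_norm_sq (c : ℝ) (w s : ℂ) :
    -2 * c * (conj w * s).re - c ^ 2 * ‖w‖ ^ 2 ≤ ‖s‖ ^ 2 := by
  rw [← Complex.normSq_eq_norm_sq, ← Complex.normSq_eq_norm_sq, Complex.normSq_apply,
    Complex.normSq_apply]
  simp only [Complex.mul_re, Complex.conj_re, Complex.conj_im]
  nlinarith [sq_nonneg (s.re + c * w.re), sq_nonneg (s.im + c * w.im)]

theorem laplacian_eventuallyEq_zero {F : Type*} [NormedAddCommGroup F]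
    [NormedSpace ℝ F] {u : EuclideanSpace ℝ (Fin d) → F} {x : EuclideanSpace ℝ (Fin d)}
    (hx : u =ᶠ[𝓝 x] fun _ => 0) : laplacian u =ᶠ[𝓝 x] fun _ => 0 := by
  have h : laplacian (fun _ : EuclideanSpace ℝ (Fin d) => (0 : F)) = fun _ => 0 := by
    funext y
    simp [laplacian]
  simpa only [h] using hx.laplacian

/-- The double commutator only depends on the multiplier on the support of `u`. -/
theorem doubleCommutator_congr {f g : EuclideanSpace ℝ (Fin d) → ℝ}
    {u : EuclideanSpace ℝ (Fin d) → ℂ} (h : ∀ x ∈ tsupport u, f x = g x) :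
    doubleCommutator f u = doubleCommutator g u := by
  have hz (x) (hx : x ∉ tsupport u) : u =ᶠ[𝓝 x] fun _ => 0 := notMem_tsupport_iff_eventuallyEq.1 hx
  have key (v : EuclideanSpace ℝ (Fin d) → ℂ) (hv : ∀ x ∉ tsupport u, v x = 0) (x) :
      (f x : ℂ) * v x = (g x : ℂ) * v x := by
    by_cases hx : x ∈ tsupport u
    · rw [h x hx]
    · simp [hv x hx]
  have k0 := key u fun x hx => (hz x hx).eq_of_nhds
  have k1 := key (laplacian u) fun x hx =>
    (laplacian_eventuallyEq_zero (hz x hx)).eq_of_nhds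
  have k2 := key (laplacian (laplacian u)) fun x hx =>
    (laplacian_eventuallyEq_zero
      (laplacian_eventuallyEq_zero (hz x hx))).eq_of_nhds
  funext x
  simp only [doubleCommutator, k0, k1, k2]

end Pointwise

/-- Lemma 2.2: `−[Δ,[Δ,|x|^β]] ≥ β(β+d−4)(d−β)|x|^{β−4}` for `β ≥ max(1, 4−d)`,
as quadratic forms on `C_c^∞(ℝ^d \ {0})`. -/
theorem double_commutator_power_bound (d : ℕ) (hd : 1 ≤ d) (β : ℝ)
    (hβ : max 1 (4 - (d : ℝ)) ≤ β)
    (u : EuclideanSpace ℝ (Fin d) → ℂ)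
    (hu : ContDiff ℝ (⊤ : ℕ∞) u) (hsupp : HasCompactSupport u)
    (h0 : (0 : EuclideanSpace ℝ (Fin d)) ∉ tsupport u) :
    (- ∫ x : EuclideanSpace ℝ (Fin d),
        conj (u x) * doubleCommutator (fun y => ‖y‖ ^ β) u x).re ≥
      β * (β + d - 4) * (d - β) *
        ∫ x : EuclideanSpace ℝ (Fin d), ‖x‖ ^ (β - 4) * ‖u x‖ ^ 2 := by
  have hβ1 : 1 ≤ β := (le_max_left _ _).trans hβ
  obtain ⟨ε, hε, hball⟩ := Metric.isOpen_iff.1 (isClosed_tsupport u).isOpen_compl 0 h0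
  have hfar : ∀ x ∈ tsupport u, ε / 2 < ‖x‖ := fun x hx => by
    by_contra! hlt
    exact hball (by simpa using hlt.trans_lt (half_lt_self hε)) hx
  obtain ⟨f, hf, hfeq⟩ := exists_contDiff_eventuallyEq_norm_rpow (d := d) (half_pos hε) β
  obtain ⟨p, hp, hpeq⟩ := exists_contDiff_eventuallyEq_norm_rpow (d := d) (half_pos hε) (β - 4)
  have hne : ∀ x ∈ tsupport u, x ≠ 0 := fun x hx h => h0 (h ▸ hx)
  have hu0 : ∀ x ∉ tsupport u, u x = 0 := fun x hx => image_eq_zero_of_notMem_tsupport hx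
  have hv : ContDiff ℝ (⊤ : ℕ∞) fun x => ‖u x‖ ^ 2 := hu.norm_sq ℝ
  have hvs : HasCompactSupport fun x => ‖u x‖ ^ 2 :=
    hsupp.comp_left (g := fun z : ℂ => ‖z‖ ^ 2) (by simp)
  set c : ℝ := (β + d - 4) / 2 with hc
  set J := ∫ x, p x * ‖u x‖ ^ 2 with hJ
  have hR : ∫ x, ‖x‖ ^ (β - 4) * ‖u x‖ ^ 2 = J := by
    refine integral_congr_ae (.of_forall fun x => ?_)
    by_cases hx : x ∈ tsupport u
    · simp only [(hpeq x (hfar x hx)).eq_of_nhds]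
    · simp [hu0 x hx]
  have hH : ∫ x, ∑ i, x i * p x * partialDeriv i (fun x => ‖u x‖ ^ 2) x = -(2 * c) * J := by
    rw [integral_weighted_radial_partialDeriv hp hv hvs, hJ, neg_mul, ← integral_const_mul]
    congr 1
    refine integral_congr_ae (.of_forall fun x => ?_)
    by_cases hx : x ∈ tsupport u
    · have hxp := hpeq x (hfar x hx)
      have hsum : ∑ i, x i * partialDeriv i p x = (β - 4) * p x := by
        simp only [(hxp.partialDeriv _).eq_of_nhds, partialDeriv_norm_rpow (hne x hx)]
        rw [hxp.eq_of_nhds, show β - 4 = β - 4 - 2 + (2 : ℕ) by push_cast; ring,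
          Real.rpow_add_natCast (norm_ne_zero_iff.2 (hne x hx)), EuclideanSpace.real_norm_sq_eq,
          Finset.mul_sum, Finset.mul_sum]
        refine Finset.sum_congr rfl fun i _ => ?_
        push_cast
        ring_nf
      simp only [hsum, hc]
      ring
    · simp [hu0 x hx]
  have hi4 : Integrable fun x => p x * ‖u x‖ ^ 2 :=
    (hp.continuous.mul hv.continuous).integrable_of_hasCompactSupport hvs.mul_left
  have hi3 : Integrable fun x : EuclideanSpace ℝ (Fin d) =>
      ∑ i, x i * p x * partialDeriv i (fun x => ‖u x‖ ^ 2) x :=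
    integrable_finsetSum _ fun i _ =>
      (((EuclideanSpace.proj (𝕜 := ℝ) i).continuous.mul hp.continuous).mul
        (hv.partialDeriv i).continuous).integrable_of_hasCompactSupport (hvs.partialDeriv i).mul_left
  have hcu (i) : Continuous fun x => conj (partialDeriv i u x) :=
    Complex.continuous_conj.comp (hu.partialDeriv i).continuous
  have hi1 : Integrable fun x => laplacian (laplacian f) x * ‖u x‖ ^ 2 - 4 * ∑ j, ∑ i,
      partialDeriv i (partialDeriv j f) x *
        (conj (partialDeriv i u x) * partialDeriv j u x).re := by
    refine .sub ?_ (.const_mul (integrable_finsetSum _ fun j _ =>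
      integrable_finsetSum _ fun i _ => ?_) 4)
    · exact (hf.laplacian.laplacian.continuous.mul
        hv.continuous).integrable_of_hasCompactSupport hvs.mul_left
    · refine (((hf.partialDeriv j).partialDeriv i).continuous.mul (Complex.continuous_re.comp
        ((hcu i).mul (hu.partialDeriv j).continuous))).integrable_of_hasCompactSupport ?_
      exact (((hsupp.partialDeriv j).mul_left).comp_left (g := Complex.re) rfl).mul_left
  have hpt : ∀ x, laplacian (laplacian f) x * ‖u x‖ ^ 2 - 4 * ∑ j, ∑ i,
      partialDeriv i (partialDeriv j f) x * (conj (partialDeriv i u x) * partialDeriv j u x).re ≤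
      (β * (β + d - 2) * (β - 2) * (β + d - 4) + 4 * β * (β - 1) * c ^ 2) * (p x * ‖u x‖ ^ 2) +
        4 * β * (β - 1) * c * ∑ i, x i * p x * partialDeriv i (fun x => ‖u x‖ ^ 2) x := fun x => by
    by_cases hx : x ∈ tsupport u
    · have hxf := hfeq x (hfar x hx)
      have hx0 := hne x hx
      have hS : ∑ i, x i * p x * partialDeriv i (fun x => ‖u x‖ ^ 2) x =
          2 * (p x * (conj (u x) * ∑ i, (x i : ℂ) * partialDeriv i u x).re) := by
        simp only [partialDeriv_norm_sq hu, Finset.mul_sum, Complex.re_sum]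
        refine Finset.sum_congr rfl fun i _ => ?_
        rw [mul_left_comm (conj (u x)), Complex.re_ofReal_mul]
        ring
      rw [hS, (hxf.laplacian.laplacian).eq_of_nhds, laplacian_laplacian_norm_rpow hx0,
        (hpeq x (hfar x hx)).eq_of_nhds]
      simp only [((hxf.partialDeriv _).partialDeriv _).eq_of_nhds]
      have h1 := hessian_norm_rpow_ge (zero_le_one.trans hβ1) hx0 fun i => partialDeriv i u x
      have h2 := mul_le_mul_of_nonneg_left (neg_two_mul_re_sub_sq_le_norm_sq c (u x)
        (∑ i, (x i : ℂ) * partialDeriv i u x)) (mul_nonneg (mul_nonneg (zero_le_one.trans hβ1)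
          (sub_nonneg.2 hβ1)) (Real.rpow_nonneg (norm_nonneg x) (β - 4)))
      linarith
    · have hv0 : ∀ i, partialDeriv i u x = 0 := partialDeriv_eq_zero_of_notMem_tsupport hx
      simp [partialDeriv_norm_sq hu, hu0 x hx, hv0]
  have hmono := integral_mono hi1 ((hi4.const_mul _).add (hi3.const_mul _)) hpt
  simp only [Pi.add_apply] at hmono
  rw [integral_add (hi4.const_mul _) (hi3.const_mul _), integral_const_mul, integral_const_mul,
    hH, ← hJ, ← re_integral_conj_mul_doubleCommutator hf hu hsupp] at hmono
  rw [hR, doubleCommutator_congr (g := f) fun x hx => ((hfeq x (hfar x hx)).eq_of_nhds).symm,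
    Complex.neg_re, ge_iff_le]
  refine le_trans (le_of_eq ?_) (neg_le_neg hmono)
  rw [hc]
  ring
end

section
/- Hardy trick inequality: let d ≥ 1, let f : ℝ^d → ℝ be smooth with pointwise positive semidefinite Hessian (i.e. f convex), and let F : ℝ^d → ℝ^d be a smooth vector field. Then for every smooth compactly supported u : ℝ^d → ℂ, ∫_{ℝ^d} Σ_{j,k=1}^{d} ∂_j conj(u) · (∂_j∂_k f) · ∂_k u dx ≥ ∫_{ℝ^d} ( Σ_{j,k=1}^{d} ∂_j( (∂_j∂_k f) F_k )(x) − Σ_{j,k=1}^{d} F_j(x) (∂_j∂_k f)(x) F_k(x) ) |u(x)|² dx. -/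
open scoped ComplexConjugate

open MeasureTheory in
/-- The integral of a directional derivative of a compactly supported `C¹` function vanishes. -/
lemma integral_fderiv_apply_eq_zero {E : Type*} [NormedAddCommGroup E] [NormedSpace ℝ E]
    [FiniteDimensional ℝ E] [MeasurableSpace E] [BorelSpace E] (μ : Measure E)
    [μ.IsAddHaarMeasure] {g : E → ℝ} (hg : ContDiff ℝ 1 g) (hsupp : HasCompactSupport g) (v : E) :
    ∫ x, fderiv ℝ g x v ∂μ = 0 := by
  have hg' : Integrable (fun x => fderiv ℝ g x v) μ :=
    ((hg.continuous_fderiv one_ne_zero).clm_apply continuous_const).integrable_of_hasCompactSupport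
      (hsupp.fderiv_apply ℝ v)
  have h := integral_mul_fderiv_eq_neg_fderiv_mul_of_integrable (μ := μ) (f := fun _ : E => (1 : ℝ))
    (g := g) (v := v) (by simp) (by simpa using hg')
    (by simpa using hg.continuous.integrable_of_hasCompactSupport hsupp)
    (fun x _ => differentiableAt_const _) (fun x _ => hg.differentiable one_ne_zero x)
  simpa using h

/-- Completing the square for a positive semidefinite symmetric real form evaluated at the complex
vector `a + z • b`. -/
lemma re_sum_conj_mul_mul_add_nonneg {ι : Type*} [Fintype ι] (H : ι → ι → ℝ)
    (hsymm : ∀ j k, H j k = H k j) (hpos : ∀ w : ι → ℝ, 0 ≤ ∑ j, ∑ k, w j * H j k * w k)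
    (a : ι → ℂ) (b : ι → ℝ) (z : ℂ) :
    0 ≤ (∑ j, ∑ k, conj (a j) * (H j k : ℂ) * a k).re +
      (∑ j, ∑ k, H j k * b k * (2 * (z.re * (a j).re + z.im * (a j).im)) +
        (∑ j, ∑ k, b j * H j k * b k) * ‖z‖ ^ 2) := by
  have hswap : ∑ j, ∑ k, H j k * b k * (z.re * (a j).re + z.im * (a j).im) =
      ∑ j, ∑ k, H j k * b j * (z.re * (a k).re + z.im * (a k).im) := by
    rw [Finset.sum_comm]
    refine Finset.sum_congr rfl fun j _ => Finset.sum_congr rfl fun k _ => ?_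
    rw [hsymm]
  refine (add_nonneg (hpos fun j => (a j).re + b j * z.re)
    (hpos fun j => (a j).im + b j * z.im)).trans_eq ?_
  have hsplit : ∑ j, ∑ k, H j k * b k * (2 * (z.re * (a j).re + z.im * (a j).im)) =
      ∑ j, ∑ k, H j k * b k * (z.re * (a j).re + z.im * (a j).im) +
        ∑ j, ∑ k, H j k * b j * (z.re * (a k).re + z.im * (a k).im) := by
    rw [← hswap, ← two_mul]
    simp only [Finset.mul_sum]
    refine Finset.sum_congr rfl fun j _ => Finset.sum_congr rfl fun k _ => by ring
  rw [hsplit, Complex.sq_norm, Complex.normSq_apply]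
  simp only [Complex.re_sum, Finset.sum_mul, ← Finset.sum_add_distrib]
  refine Finset.sum_congr rfl fun j _ => Finset.sum_congr rfl fun k _ => ?_
  simp only [Complex.mul_re, Complex.mul_im, Complex.conj_re, Complex.conj_im, Complex.ofReal_re,
    Complex.ofReal_im]
  ring

lemma fderiv_norm_sq_comp_apply {E : Type*} [NormedAddCommGroup E] [NormedSpace ℝ E] {u : E → ℂ}
    {x : E} (hu : DifferentiableAt ℝ u x) (v : E) :
    fderiv ℝ (fun y => ‖u y‖ ^ 2) x v =
      2 * ((u x).re * (fderiv ℝ u x v).re + (u x).im * (fderiv ℝ u x v).im) := by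
  rw [hu.hasFDerivAt.norm_sq.fderiv]
  simp [Complex.inner, Complex.mul_re]
  ring

open MeasureTheory in
/-- Hardy trick inequality (eq:Hardy-trick): for convex `f` and any smooth vector
field `F`, `∫ ⟨∇u, (Hess f)∇u⟩ ≥ ∫ (div((Hess f)F) − F·(Hess f)F)|u|²`. -/
theorem hardy_trick_inequality (d : ℕ) (hd : 1 ≤ d)
    (f : EuclideanSpace ℝ (Fin d) → ℝ) (hf : ContDiff ℝ (⊤ : ℕ∞) f)
    (hconv : ∀ (x v : EuclideanSpace ℝ (Fin d)),
      0 ≤ fderiv ℝ (fun y => fderiv ℝ f y v) x v)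
    (F : EuclideanSpace ℝ (Fin d) → EuclideanSpace ℝ (Fin d)) (hF : ContDiff ℝ (⊤ : ℕ∞) F)
    (u : EuclideanSpace ℝ (Fin d) → ℂ)
    (hu : ContDiff ℝ (⊤ : ℕ∞) u) (hsupp : HasCompactSupport u) :
    (∫ x : EuclideanSpace ℝ (Fin d), ∑ j, ∑ k,
        conj (fderiv ℝ u x (EuclideanSpace.single j 1)) *
          ((fderiv ℝ (fun y => fderiv ℝ f y (EuclideanSpace.single k 1)) x
              (EuclideanSpace.single j 1) : ℝ) : ℂ) *
          fderiv ℝ u x (EuclideanSpace.single k 1)).re ≥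
      ∫ x : EuclideanSpace ℝ (Fin d),
        ((∑ j, ∑ k, fderiv ℝ
            (fun y => (fderiv ℝ (fun z => fderiv ℝ f z (EuclideanSpace.single k 1)) y
                (EuclideanSpace.single j 1)) * F y k) x (EuclideanSpace.single j 1))
          - ∑ j, ∑ k, F x j *
              (fderiv ℝ (fun z => fderiv ℝ f z (EuclideanSpace.single k 1)) x
                (EuclideanSpace.single j 1)) * F x k) * ‖u x‖ ^ 2 := by
  set e : Fin d → EuclideanSpace ℝ (Fin d) := fun j => EuclideanSpace.single j 1
  have hf2 : ContDiff ℝ (⊤ : ℕ∞) (fderiv ℝ f) := hf.fderiv_right (by simp)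
  have hHess (x v w : EuclideanSpace ℝ (Fin d)) :
      fderiv ℝ (fun y => fderiv ℝ f y v) x w = fderiv ℝ (fderiv ℝ f) x w v := by
    rw [fderiv_clm_apply (hf2.differentiable (by simp) x) (differentiableAt_const v)]
    simp
  set H : Fin d → Fin d → EuclideanSpace ℝ (Fin d) → ℝ :=
    fun j k x => fderiv ℝ (fun z => fderiv ℝ f z (e k)) x (e j) with hH
  have hHsmooth (j k) : ContDiff ℝ (⊤ : ℕ∞) (H j k) :=
    ((hf2.clm_apply contDiff_const).fderiv_right (m := (⊤ : ℕ∞)) (by simp)).clm_apply contDiff_const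
  have hHsymm (x) (j k) : H j k x = H k j x := by
    simp only [hH, hHess]
    exact hf.contDiffAt.isSymmSndFDerivAt (by simpa using WithTop.coe_le_coe.2 (le_top (a := (2 : ℕ∞)))) _ _
  have hHpos (x) (w : Fin d → ℝ) : 0 ≤ ∑ j, ∑ k, w j * H j k x * w k := by
    refine (hconv x (∑ j, w j • e j)).trans_eq ?_
    rw [hHess]
    simp only [hH, hHess, map_sum, map_smul, sum_apply,
      smul_apply, smul_eq_mul, Finset.mul_sum]
    rw [Finset.sum_comm]
    refine Finset.sum_congr rfl fun j _ => Finset.sum_congr rfl fun k _ => by ring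
  have hFsmooth (k) : ContDiff ℝ (⊤ : ℕ∞) fun x => F x k := contDiff_euclidean.1 hF k
  have hGsmooth (j k) : ContDiff ℝ (⊤ : ℕ∞) fun x => H j k x * F x k :=
    (hHsmooth j k).mul (hFsmooth k)
  have hφ : ContDiff ℝ (⊤ : ℕ∞) fun x => ‖u x‖ ^ 2 := hu.norm_sq ℝ
  have hφsupp : HasCompactSupport fun x => ‖u x‖ ^ 2 :=
    hsupp.comp_left (g := fun z : ℂ => ‖z‖ ^ 2) (by simp)
  have hGφ (j k) : ContDiff ℝ 1 fun x => H j k x * F x k * ‖u x‖ ^ 2 :=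
    ((hGsmooth j k).mul hφ).of_le (by simp)
  have hGφsupp (j k) : HasCompactSupport fun x => H j k x * F x k * ‖u x‖ ^ 2 :=
    hφsupp.mul_left
  have hDint (j k) :
      Integrable fun x => fderiv ℝ (fun y => H j k y * F y k * ‖u y‖ ^ 2) x (e j) :=
    (((hGφ j k).continuous_fderiv one_ne_zero).clm_apply
      continuous_const).integrable_of_hasCompactSupport ((hGφsupp j k).fderiv_apply ℝ (e j))
  have hDzero : ∫ x, ∑ j, ∑ k, fderiv ℝ (fun y => H j k y * F y k * ‖u y‖ ^ 2) x (e j) = 0 := by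
    rw [integral_finsetSum _ fun j _ => integrable_finsetSum _ fun k _ => hDint j k]
    refine Finset.sum_eq_zero fun j _ => ?_
    rw [integral_finsetSum _ fun k _ => hDint j k]
    exact Finset.sum_eq_zero fun k _ =>
      integral_fderiv_apply_eq_zero volume (hGφ j k) (hGφsupp j k) (e j)
  have hDapply (x) (j k) : fderiv ℝ (fun y => H j k y * F y k * ‖u y‖ ^ 2) x (e j) =
      fderiv ℝ (fun y => H j k y * F y k) x (e j) * ‖u x‖ ^ 2 + H j k x * F x k *
        (2 * ((u x).re * (fderiv ℝ u x (e j)).re + (u x).im * (fderiv ℝ u x (e j)).im)) := by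
    rw [fderiv_fun_mul ((hGsmooth j k).differentiable (by simp) x)
      (hφ.differentiable (by simp) x), ← fderiv_norm_sq_comp_apply (hu.differentiable (by simp) x)]
    simp only [add_apply, smul_apply, smul_eq_mul]
    ring
  have hu' (j) : Continuous fun x => fderiv ℝ u x (e j) :=
    (hu.continuous_fderiv (by simp)).clm_apply continuous_const
  have hQint : Integrable fun x =>
      ∑ j, ∑ k, conj (fderiv ℝ u x (e j)) * (H j k x : ℂ) * fderiv ℝ u x (e k) :=
    integrable_finsetSum _ fun j _ => integrable_finsetSum _ fun k _ =>
      (((Complex.continuous_conj.comp (hu' j)).mul (Complex.continuous_ofReal.comp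
        (hHsmooth j k).continuous)).mul (hu' k)).integrable_of_hasCompactSupport
        (hsupp.fderiv_apply ℝ (e k)).mul_left
  have hRcont : Continuous fun x =>
      ((∑ j, ∑ k, fderiv ℝ (fun y => H j k y * F y k) x (e j)) -
        ∑ j, ∑ k, F x j * H j k x * F x k) * ‖u x‖ ^ 2 := by
    refine ((continuous_finsetSum _ fun j _ => continuous_finsetSum _ fun k _ => ?_).sub
      (continuous_finsetSum _ fun j _ => continuous_finsetSum _ fun k _ => ?_)).mul hφ.continuous
    · exact ((hGsmooth j k).continuous_fderiv (by simp)).clm_apply continuous_const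
    · exact ((hFsmooth j).continuous.mul (hHsmooth j k).continuous).mul (hFsmooth k).continuous
  have hRint := hRcont.integrable_of_hasCompactSupport (μ := volume) hφsupp.mul_left
  have hQre : Integrable fun x =>
      (∑ j, ∑ k, conj (fderiv ℝ u x (e j)) * (H j k x : ℂ) * fderiv ℝ u x (e k)).re := hQint.re
  have hD : Integrable fun x =>
      ∑ j, ∑ k, fderiv ℝ (fun y => H j k y * F y k * ‖u y‖ ^ 2) x (e j) :=
    integrable_finsetSum _ fun j _ => integrable_finsetSum _ fun k _ => hDint j k
  have hre := integral_re hQint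
  simp only [RCLike.re_to_complex] at hre
  rw [ge_iff_le, ← hre, ← add_zero (∫ x, Complex.re _), ← hDzero, ← integral_add hQre hD]
  refine integral_mono hRint (hQre.add hD) fun x => ?_
  have key := re_sum_conj_mul_mul_add_nonneg (fun j k => H j k x) (hHsymm x) (hHpos x)
    (fun j => fderiv ℝ u x (e j)) (fun j => F x j) (u x)
  simp only [← Finset.sum_mul] at key
  change ((∑ j, ∑ k, fderiv ℝ (fun y => H j k y * F y k) x (e j)) -
      ∑ j, ∑ k, F x j * H j k x * F x k) * ‖u x‖ ^ 2 ≤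
    (∑ j, ∑ k, conj (fderiv ℝ u x (e j)) * (H j k x : ℂ) * fderiv ℝ u x (e k)).re +
      ∑ j, ∑ k, fderiv ℝ (fun y => H j k y * F y k * ‖u y‖ ^ 2) x (e j)
  simp only [hDapply, Finset.sum_add_distrib, ← Finset.sum_mul, sub_mul]
  linarith
end

section
/- Hardy-type positivity for the cubic weight in dimension 3: for every smooth compactly supported function u : ℝ³ → ℂ, ∫_{ℝ³} |x| ( |∇u(x)|² + |ω_x · ∇u(x)|² ) dx ≥ 2 ∫_{ℝ³} |u(x)|² / |x| dx, where ω_x = x/|x| and ω_x · ∇u is the radial derivative of u. -/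
open MeasureTheory Module Topology

theorem HasCompactSupport.fderiv_self {E F : Type*} [NormedAddCommGroup E] [NormedSpace ℝ E]
    [NormedAddCommGroup F] [NormedSpace ℝ F] {f : E → F}
    (hs : HasCompactSupport f) : HasCompactSupport fun x ↦ fderiv ℝ f x x :=
  (hs.fderiv (𝕜 := ℝ)).mono fun x hx h ↦ hx (by simp [h])

section HardyInequality

variable {E F : Type*} [NormedAddCommGroup E] [InnerProductSpace ℝ E] [FiniteDimensional ℝ E]
  [MeasurableSpace E] [BorelSpace E] [NormedAddCommGroup F] [InnerProductSpace ℝ F]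

theorem locallyIntegrable_norm_inv (hd : 2 ≤ finrank ℝ E) :
    LocallyIntegrable (fun x : E ↦ ‖x‖⁻¹) := by
  refine locallyIntegrable_of_norm_le_rpow (C := 1) (α := 1) (by omega) ?_
    (ae_of_all _ fun x ↦ ?_) (by fun_prop)
  · exact_mod_cast hd
  · simp [Real.rpow_neg_one]

/-- Integration by parts for the radial vector field `‖x‖⁻¹ • x`, whose divergence is
`(d - 1) / ‖x‖`. -/
theorem integral_norm_inv_mul_fderiv_self (hd : 2 ≤ finrank ℝ E) {f : E → ℝ}
    (hf : ContDiff ℝ 1 f) (hs : HasCompactSupport f) :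
    ∫ x, ‖x‖⁻¹ * fderiv ℝ f x x = (1 - finrank ℝ E : ℝ) * ∫ x, ‖x‖⁻¹ * f x := by
  have hloc := locallyIntegrable_norm_inv hd
  have hdf : Continuous (fderiv ℝ f) := hf.continuous_fderiv one_ne_zero
  obtain ⟨C, hC⟩ := hs.fderiv (𝕜 := ℝ) |>.exists_bound_of_continuous hdf
  obtain ⟨R, hR, hsR⟩ := hs.isCompact.isBounded.exists_pos_norm_lt
  have hsupp : ∀ x, R ≤ ‖x‖ → fderiv ℝ f x = 0 := fun x hx ↦ by
    by_contra h
    exact (hsR x (support_fderiv_subset ℝ h)).not_ge hx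
  have hC0 : 0 ≤ C := (norm_nonneg _).trans (hC 0)
  have hderiv : HasDerivAt (fun t : ℝ ↦ ∫ x, ‖x‖⁻¹ * f (t • x))
      (∫ x, ‖x‖⁻¹ * fderiv ℝ f ((1 : ℝ) • x) x) 1 := by
    refine (hasDerivAt_integral_of_dominated_loc_of_deriv_le
      (F' := fun t x ↦ ‖x‖⁻¹ * fderiv ℝ f (t • x) x)
      (bound := (Metric.closedBall (0 : E) (2 * R)).indicator fun _ ↦ C)
      (Ioi_mem_nhds (show (1 / 2 : ℝ) < 1 by norm_num)) (.of_forall fun t ↦ ?_) ?_ ?_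
      (ae_of_all _ fun x t ht ↦ ?_) ?_ (ae_of_all _ fun x t _ ↦ ?_)).2
    · have := hf.continuous
      exact (by fun_prop : AEStronglyMeasurable (fun x : E ↦ ‖x‖⁻¹)).mul
        (by fun_prop : Continuous fun x ↦ f (t • x)).aestronglyMeasurable
    · simpa using hloc.integrable_smul_right_of_hasCompactSupport hf.continuous hs
    · exact (by fun_prop : AEStronglyMeasurable (fun x : E ↦ ‖x‖⁻¹)).mul
        (by fun_prop : Continuous fun x ↦ fderiv ℝ f ((1 : ℝ) • x) x).aestronglyMeasurable
    · have ht : (1 / 2 : ℝ) < t := ht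
      by_cases hx : ‖x‖ ≤ 2 * R
      · rw [Set.indicator_of_mem (by simpa using hx), norm_mul, norm_inv, norm_norm]
        calc ‖x‖⁻¹ * ‖fderiv ℝ f (t • x) x‖ ≤ ‖x‖⁻¹ * (C * ‖x‖) := by
              gcongr; exact (fderiv ℝ f (t • x)).le_of_opNorm_le (hC _) x
          _ = (‖x‖⁻¹ * ‖x‖) * C := by ring
          _ ≤ C := mul_le_of_le_one_left hC0 (inv_mul_le_one)
      · rw [Set.indicator_of_notMem (by simpa using hx), hsupp (t • x)]
        · simp
        · rw [norm_smul, Real.norm_eq_abs, abs_of_pos (by linarith)]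
          nlinarith [norm_nonneg x]
    · exact (integrable_indicator_iff measurableSet_closedBall).2
        (integrableOn_const (isCompact_closedBall _ _).measure_ne_top)
    · have h1 : HasDerivAt (fun s : ℝ ↦ s • x) x t := by
        simpa using (hasDerivAt_id t).smul_const x
      exact ((hf.differentiable one_ne_zero (t • x)).hasFDerivAt.comp_hasDerivAt t h1).const_mul _
  have hscale : (fun t : ℝ ↦ ∫ x, ‖x‖⁻¹ * f (t • x)) =ᶠ[𝓝 1]
      fun t ↦ (t * (t ^ finrank ℝ E)⁻¹) * ∫ x, ‖x‖⁻¹ * f x := by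
    filter_upwards [Ioi_mem_nhds (zero_lt_one (α := ℝ))] with t (ht : 0 < t)
    have := Measure.integral_comp_smul_of_nonneg volume (fun x : E ↦ ‖x‖⁻¹ * f x) t (hR := ht.le)
    rw [mul_assoc, ← smul_eq_mul (t ^ finrank ℝ E)⁻¹, ← this, ← integral_const_mul]
    congr with x
    rw [norm_smul, Real.norm_eq_abs, abs_of_pos ht]
    field_simp
  have hpow : HasDerivAt (fun t : ℝ ↦ t * (t ^ finrank ℝ E)⁻¹) (1 - finrank ℝ E : ℝ) 1 := by
    convert! (hasDerivAt_id (1 : ℝ)).mul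
      ((hasDerivAt_pow (finrank ℝ E) (1 : ℝ)).inv (by simp)) using 1
    simp [sub_eq_add_neg]
  simpa using hderiv.unique ((hpow.mul_const _).congr_of_eventuallyEq hscale)

theorem integrable_norm_inv_mul_norm_fderiv_self_sq (hd : 2 ≤ finrank ℝ E) {u : E → F}
    (hu : ContDiff ℝ 1 u) (hs : HasCompactSupport u) :
    Integrable fun x ↦ ‖x‖⁻¹ * ‖fderiv ℝ u x x‖ ^ 2 := by
  have hdu : Continuous (fderiv ℝ u) := hu.continuous_fderiv one_ne_zero
  exact (locallyIntegrable_norm_inv hd).integrable_smul_right_of_hasCompactSupport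
    (by fun_prop) (hs.fderiv_self.comp_left (g := fun y ↦ ‖y‖ ^ 2) (by simp))

/-- The radial Hardy inequality with weight `‖x‖`. -/
theorem radial_hardy_inequality (hd : 2 ≤ finrank ℝ E) {u : E → F}
    (hu : ContDiff ℝ 1 u) (hs : HasCompactSupport u) :
    ((finrank ℝ E - 1 : ℝ) / 2) ^ 2 * ∫ x, ‖x‖⁻¹ * ‖u x‖ ^ 2 ≤
      ∫ x, ‖x‖⁻¹ * ‖fderiv ℝ u x x‖ ^ 2 := by
  set c : ℝ := (finrank ℝ E - 1 : ℝ) / 2 with hc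
  have hloc := locallyIntegrable_norm_inv hd
  have hdu : Continuous (fderiv ℝ u) := hu.continuous_fderiv one_ne_zero
  have hsq : HasCompactSupport fun x ↦ ‖u x‖ ^ 2 :=
    hs.comp_left (g := fun y ↦ ‖y‖ ^ 2) (by simp)
  have hibp := integral_norm_inv_mul_fderiv_self hd (hu.norm_sq ℝ) hsq
  have hderiv : ∀ x, fderiv ℝ (fun y ↦ ‖u y‖ ^ 2) x x = 2 * inner ℝ (u x) (fderiv ℝ u x x) := by
    intro x
    rw [((hu.differentiable one_ne_zero x).hasFDerivAt.norm_sq :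
      HasFDerivAt (fun y ↦ ‖u y‖ ^ 2) _ x).fderiv]
    simp
  simp_rw [hderiv] at hibp
  have hi₁ := integrable_norm_inv_mul_norm_fderiv_self_sq hd hu hs
  have hi₂ : Integrable fun x ↦ ‖x‖⁻¹ * (2 * inner ℝ (u x) (fderiv ℝ u x x)) := by
    have := hu.continuous
    exact hloc.integrable_smul_right_of_hasCompactSupport (by fun_prop)
      (hs.mono fun x hx h ↦ hx (by simp [h]))
  have hi₃ : Integrable fun x ↦ ‖x‖⁻¹ * ‖u x‖ ^ 2 :=
    hloc.integrable_smul_right_of_hasCompactSupport (hu.norm_sq ℝ).continuous hsq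
  have hnonneg : 0 ≤ ∫ x, ‖x‖⁻¹ * ‖fderiv ℝ u x x + c • u x‖ ^ 2 :=
    integral_nonneg fun x ↦ by positivity
  have hexpand : ∀ x, ‖x‖⁻¹ * ‖fderiv ℝ u x x + c • u x‖ ^ 2 =
      ‖x‖⁻¹ * ‖fderiv ℝ u x x‖ ^ 2 + c * (‖x‖⁻¹ * (2 * inner ℝ (u x) (fderiv ℝ u x x)))
        + c ^ 2 * (‖x‖⁻¹ * ‖u x‖ ^ 2) := fun x ↦ by
    rw [norm_add_sq_real, inner_smul_right, norm_smul, real_inner_comm, mul_pow,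
      Real.norm_eq_abs, sq_abs]
    ring
  simp_rw [hexpand] at hnonneg
  have hi₁₂ : Integrable fun x ↦ ‖x‖⁻¹ * ‖fderiv ℝ u x x‖ ^ 2 +
      c * (‖x‖⁻¹ * (2 * inner ℝ (u x) (fderiv ℝ u x x))) := hi₁.add (hi₂.const_mul c)
  rw [integral_add hi₁₂ (hi₃.const_mul _),
    integral_add hi₁ (hi₂.const_mul c), integral_const_mul, integral_const_mul, hibp,
    show (1 - finrank ℝ E : ℝ) = -(2 * c) by rw [hc]; ring] at hnonneg
  linarith

end HardyInequality

theorem OrthonormalBasis.norm_apply_sq_le {ι E F : Type*} [Fintype ι] [NormedAddCommGroup E]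
    [InnerProductSpace ℝ E] [NormedAddCommGroup F] [NormedSpace ℝ F]
    (b : OrthonormalBasis ι ℝ E) (L : E →L[ℝ] F) (v : E) :
    ‖L v‖ ^ 2 ≤ ‖v‖ ^ 2 * ∑ i, ‖L (b i)‖ ^ 2 := by
  calc ‖L v‖ ^ 2 = ‖∑ i, inner ℝ (b i) v • L (b i)‖ ^ 2 := by
        conv_lhs => rw [← b.sum_repr' v]
        simp
    _ ≤ (∑ i, ‖inner ℝ (b i) v‖ * ‖L (b i)‖) ^ 2 := by
        gcongr
        exact norm_sum_le_of_le _ fun i _ ↦ (norm_smul _ _).le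
    _ ≤ (∑ i, ‖inner ℝ (b i) v‖ ^ 2) * ∑ i, ‖L (b i)‖ ^ 2 :=
        Finset.sum_mul_sq_le_sq_mul_sq _ _ _
    _ = ‖v‖ ^ 2 * ∑ i, ‖L (b i)‖ ^ 2 := by rw [b.sum_sq_norm_inner_right]

/-- Hardy-type positivity for the cubic weight in dimension 3:
`∫ |x|(|∇u|² + |ω_x·∇u|²) ≥ 2 ∫ |u|²/|x|` for `u ∈ C_c^∞(ℝ³)`. -/
theorem cubic_weight_hardy_positivity (u : EuclideanSpace ℝ (Fin 3) → ℂ)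
    (hu : ContDiff ℝ (⊤ : ℕ∞) u) (hsupp : HasCompactSupport u) :
    ∫ x : EuclideanSpace ℝ (Fin 3),
        ‖x‖ * ((∑ i, ‖fderiv ℝ u x (EuclideanSpace.single i 1)‖ ^ 2)
          + ‖fderiv ℝ u x (‖x‖⁻¹ • x)‖ ^ 2) ≥
      2 * ∫ x : EuclideanSpace ℝ (Fin 3), ‖u x‖ ^ 2 / ‖x‖ := by
  have hd : 2 ≤ finrank ℝ (EuclideanSpace ℝ (Fin 3)) := by simp
  have hu₁ : ContDiff ℝ 1 u := hu.of_le (by exact_mod_cast le_top)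
  have hdu : Continuous (fderiv ℝ u) := hu₁.continuous_fderiv one_ne_zero
  have hrad : ∀ x, ‖x‖ * ‖fderiv ℝ u x (‖x‖⁻¹ • x)‖ ^ 2 = ‖x‖⁻¹ * ‖fderiv ℝ u x x‖ ^ 2 := by
    intro x
    rcases eq_or_ne x 0 with rfl | hx
    · simp
    · have := norm_ne_zero_iff.2 hx
      rw [map_smul, norm_smul, norm_inv, norm_norm]
      field_simp
  have hle : ∀ x, ‖x‖⁻¹ * ‖fderiv ℝ u x x‖ ^ 2 ≤
      ‖x‖ * ∑ i, ‖fderiv ℝ u x (EuclideanSpace.single i 1)‖ ^ 2 := by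
    intro x
    have := (EuclideanSpace.basisFun (Fin 3) ℝ).norm_apply_sq_le (fderiv ℝ u x) (‖x‖⁻¹ • x)
    simp only [EuclideanSpace.basisFun_apply] at this
    rw [← hrad]
    gcongr
    refine this.trans (mul_le_of_le_one_left (by positivity) ?_)
    rw [norm_smul, norm_inv, norm_norm]
    exact pow_le_one₀ (by positivity) inv_mul_le_one
  have hi := integrable_norm_inv_mul_norm_fderiv_self_sq hd hu₁ hsupp
  have hi' : Integrable fun x ↦
      ‖x‖ * ∑ i, ‖fderiv ℝ u x (EuclideanSpace.single i 1)‖ ^ 2 := by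
    refine Continuous.integrable_of_hasCompactSupport (by fun_prop)
      ((hsupp.fderiv (𝕜 := ℝ)).mono fun x hx h ↦ hx (by simp [h]))
  have hardy := radial_hardy_inequality hd hu₁ hsupp
  have hmono := integral_mono hi hi' hle
  simp_rw [mul_add, hrad, div_eq_inv_mul]
  rw [integral_add hi' hi]
  norm_num at hardy
  linarith
end

section
/- Hydrogen bound for the Coulomb potential: for every Schwartz function u : ℝ³ → ℂ and every point x ∈ ℝ³, ∫_{ℝ³} |u(y)|² / |x − y| dy ≤ ‖u‖_{L²(ℝ³)} · ‖∇u‖_{L²(ℝ³)}, where ‖u‖_{L²} = (∫|u|²)^{1/2} and ‖∇u‖_{L²} = (∫|∇u|²)^{1/2}. -/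
open MeasureTheory Filter Topology

namespace CoulombHydrogen

/-- The `i`-th component of the regularized radial field `y ↦ (y - x) / √(‖y - x‖² + ε)`. -/
noncomputable def radialField (x : EuclideanSpace ℝ (Fin 3)) (ε : ℝ) (i : Fin 3)
    (y : EuclideanSpace ℝ (Fin 3)) : ℝ :=
  (y i - x i) * (√(‖y - x‖ ^ 2 + ε))⁻¹

/-- The derivative of the `i`-th component of the regularized radial field in direction `i`. -/
noncomputable def radialFieldDeriv (x : EuclideanSpace ℝ (Fin 3)) (ε : ℝ) (i : Fin 3)
    (y : EuclideanSpace ℝ (Fin 3)) : ℝ :=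
  (√(‖y - x‖ ^ 2 + ε))⁻¹ - (y i - x i) ^ 2 * (√(‖y - x‖ ^ 2 + ε))⁻¹ ^ 3

variable {x y : EuclideanSpace ℝ (Fin 3)} {ε : ℝ} {i : Fin 3}

lemma sqrt_reg_pos (hε : 0 < ε) : 0 < √(‖y - x‖ ^ 2 + ε) :=
  Real.sqrt_pos.2 (by positivity)

lemma inv_sqrt_reg_sq_mul (hε : 0 < ε) :
    (√(‖y - x‖ ^ 2 + ε))⁻¹ ^ 2 * (‖y - x‖ ^ 2 + ε) = 1 := by
  have h : 0 < ‖y - x‖ ^ 2 + ε := by positivity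
  rw [inv_pow, Real.sq_sqrt h.le, inv_mul_cancel₀ h.ne']

lemma norm_sub_sq : ‖y - x‖ ^ 2 = ∑ i, (y i - x i) ^ 2 := by
  simp [EuclideanSpace.real_norm_sq_eq]

lemma continuous_inv_sqrt_reg (hε : 0 < ε) :
    Continuous fun y : EuclideanSpace ℝ (Fin 3) => (√(‖y - x‖ ^ 2 + ε))⁻¹ :=
  Continuous.inv₀ (by fun_prop) fun _ => (sqrt_reg_pos hε).ne'

lemma continuous_radialField (hε : 0 < ε) : Continuous (radialField x ε i) := by
  have := continuous_inv_sqrt_reg (x := x) hε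
  unfold radialField
  fun_prop

lemma continuous_radialFieldDeriv (hε : 0 < ε) : Continuous (radialFieldDeriv x ε i) := by
  have := continuous_inv_sqrt_reg (x := x) hε
  unfold radialFieldDeriv
  fun_prop

lemma sum_sq_radialField_le_one (hε : 0 < ε) : ∑ i, radialField x ε i y ^ 2 ≤ 1 := by
  simp only [radialField, mul_pow]
  rw [← Finset.sum_mul, ← norm_sub_sq]
  nlinarith [inv_sqrt_reg_sq_mul (x := x) (y := y) hε,
    mul_nonneg hε.le (sq_nonneg (√(‖y - x‖ ^ 2 + ε))⁻¹)]

lemma norm_radialField_le_one (hε : 0 < ε) : ‖radialField x ε i y‖ ≤ 1 := by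
  rw [Real.norm_eq_abs, ← sq_le_one_iff_abs_le_one]
  exact (Finset.single_le_sum (f := fun i => radialField x ε i y ^ 2)
    (fun _ _ => sq_nonneg _) (Finset.mem_univ i)).trans (sum_sq_radialField_le_one hε)

lemma inv_sqrt_reg_le (hε : 0 < ε) : (√(‖y - x‖ ^ 2 + ε))⁻¹ ≤ (√ε)⁻¹ :=
  inv_anti₀ (Real.sqrt_pos.2 hε) (Real.sqrt_le_sqrt (by nlinarith [sq_nonneg ‖y - x‖]))

lemma norm_radialFieldDeriv_le (hε : 0 < ε) : ‖radialFieldDeriv x ε i y‖ ≤ (√ε)⁻¹ := by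
  have hs := inv_pos.2 (sqrt_reg_pos (x := x) (y := y) hε)
  have h1 : radialFieldDeriv x ε i y =
      (√(‖y - x‖ ^ 2 + ε))⁻¹ * (1 - radialField x ε i y ^ 2) := by
    simp only [radialField, radialFieldDeriv]; ring
  have h2 : radialField x ε i y ^ 2 ≤ 1 :=
    (sq_le_one_iff_abs_le_one _).2 (norm_radialField_le_one hε)
  rw [h1, Real.norm_of_nonneg (mul_nonneg hs.le (by linarith))]
  refine le_trans ?_ (inv_sqrt_reg_le (x := x) (y := y) hε)
  exact mul_le_of_le_one_right hs.le (by nlinarith [sq_nonneg (radialField x ε i y)])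

/-- The divergence of the regularized radial field dominates `2 / √(‖y - x‖² + ε)`. -/
lemma two_mul_le_sum_radialFieldDeriv (hε : 0 < ε) :
    2 * (√(‖y - x‖ ^ 2 + ε))⁻¹ ≤ ∑ i, radialFieldDeriv x ε i y := by
  have hs := inv_pos.2 (sqrt_reg_pos (x := x) (y := y) hε)
  have h1 : ∑ i, radialFieldDeriv x ε i y =
      (√(‖y - x‖ ^ 2 + ε))⁻¹ * (3 - ∑ i, radialField x ε i y ^ 2) := by
    simp only [radialField, radialFieldDeriv, Fin.sum_univ_three]; ring
  rw [h1]
  nlinarith [sum_sq_radialField_le_one (x := x) (y := y) hε]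

lemma hasLineDerivAt_radialField (hε : 0 < ε) :
    HasLineDerivAt ℝ (radialField x ε i) (radialFieldDeriv x ε i y) y
      (EuclideanSpace.single i 1) := by
  have hD : 0 < ‖y - x‖ ^ 2 + ε := by positivity
  have hcoord (t : ℝ) : (y + t • EuclideanSpace.single i (1 : ℝ)) i = y i + t := by simp
  have hnorm (t : ℝ) : ‖y + t • EuclideanSpace.single i (1 : ℝ) - x‖ ^ 2 =
      ‖y - x‖ ^ 2 + 2 * t * (y i - x i) + t ^ 2 := by
    rw [add_sub_right_comm, norm_add_sq_real, real_inner_smul_right, norm_smul]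
    simp [EuclideanSpace.inner_single_right]
    ring
  unfold HasLineDerivAt
  simp only [radialField, hcoord, hnorm]
  have h1 : HasDerivAt (fun t : ℝ => ‖y - x‖ ^ 2 + 2 * t * (y i - x i) + t ^ 2 + ε)
      (2 * (y i - x i)) 0 := by
    have := ((((hasDerivAt_id (0 : ℝ)).const_mul 2).mul_const (y i - x i)).const_add
      (‖y - x‖ ^ 2)).add ((hasDerivAt_id (0 : ℝ)).pow 2) |>.add_const ε
    convert! this using 1
    simp
  have h2 := (h1.sqrt (by simpa using hD.ne')).inv (by simpa using (sqrt_reg_pos hε).ne')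
  have h3 := (((hasDerivAt_id (0 : ℝ)).const_add (y i)).sub_const (x i)).mul h2
  convert! h3 using 1
  have hs := (sqrt_reg_pos (x := x) (y := y) hε).ne'
  simp [radialFieldDeriv]
  field_simp
  ring

variable (u : SchwartzMap (EuclideanSpace ℝ (Fin 3)) ℂ)

/-- The Euclidean norm of the gradient of `u`. -/
noncomputable def gradNorm (y : EuclideanSpace ℝ (Fin 3)) : ℝ :=
  √(∑ i, ‖fderiv ℝ (fun z => u z) y (EuclideanSpace.single i 1)‖ ^ 2)

lemma exists_schwartz_partial (i : Fin 3) : ∃ v : SchwartzMap (EuclideanSpace ℝ (Fin 3)) ℂ,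
    ∀ y, v y = fderiv ℝ (fun z => u z) y (EuclideanSpace.single i 1) :=
  ⟨LineDeriv.lineDerivOp (EuclideanSpace.single i (1 : ℝ)) u,
    fun y => SchwartzMap.lineDerivOp_apply_eq_fderiv _ u y⟩

lemma integrable_norm_sq : Integrable fun y => ‖u y‖ ^ 2 :=
  (u.memLp 2).norm.integrable_sq

lemma integrable_partial_norm_sq (i : Fin 3) :
    Integrable fun y => ‖fderiv ℝ (fun z => u z) y (EuclideanSpace.single i 1)‖ ^ 2 := by
  obtain ⟨v, hv⟩ := exists_schwartz_partial u i
  simpa only [hv] using integrable_norm_sq v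

lemma gradNorm_sq (y : EuclideanSpace ℝ (Fin 3)) :
    gradNorm u y ^ 2 = ∑ i, ‖fderiv ℝ (fun z => u z) y (EuclideanSpace.single i 1)‖ ^ 2 :=
  Real.sq_sqrt (Finset.sum_nonneg fun _ _ => sq_nonneg _)

lemma memLp_gradNorm : MemLp (gradNorm u) 2 := by
  have h : Integrable fun y => gradNorm u y ^ 2 := by
    simp only [gradNorm_sq]
    exact integrable_finsetSum _ fun i _ => integrable_partial_norm_sq u i
  refine (memLp_two_iff_integrable_sq ?_).2 h
  have := h.aestronglyMeasurable.aemeasurable.sqrt.aestronglyMeasurable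
  refine this.congr (Eventually.of_forall fun y => ?_)
  exact Real.sqrt_sq (Real.sqrt_nonneg _)

lemma integral_norm_mul_gradNorm_le :
    ∫ y, ‖u y‖ * gradNorm u y ≤ √(∫ y, ‖u y‖ ^ 2) *
      √(∫ y, ∑ i, ‖fderiv ℝ (fun z => u z) y (EuclideanSpace.single i 1)‖ ^ 2) := by
  have h := integral_mul_le_Lp_mul_Lq_of_nonneg (μ := volume) Real.HolderConjugate.two_two
    (f := fun y => ‖u y‖) (g := gradNorm u)
    (Eventually.of_forall fun _ => norm_nonneg _)
    (Eventually.of_forall fun _ => Real.sqrt_nonneg _)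
    (by simpa using (u.memLp 2).norm) (by simpa using memLp_gradNorm u)
  simpa only [Real.rpow_two, ← Real.sqrt_eq_rpow, gradNorm_sq] using h

lemma hasLineDerivAt_norm_sq (v : EuclideanSpace ℝ (Fin 3)) (y : EuclideanSpace ℝ (Fin 3)) :
    HasLineDerivAt ℝ (fun y => ‖u y‖ ^ 2) (2 * inner ℝ (u y) (fderiv ℝ (fun z => u z) y v))
      y v := by
  have := (u.hasFDerivAt y).norm_sq.hasLineDerivAt v
  simpa [mul_add] using this

lemma integrable_inner_partial (i : Fin 3) : Integrable fun y =>
    2 * inner ℝ (u y) (fderiv ℝ (fun z => u z) y (EuclideanSpace.single i 1)) := by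
  obtain ⟨v, hv⟩ := exists_schwartz_partial u i
  simp only [← hv]
  refine Integrable.const_mul ?_ 2
  refine ((u.memLp 2).norm.integrable_mul (v.memLp 2).norm).mono
    (u.continuous.inner (𝕜 := ℝ) v.continuous).aestronglyMeasurable (Eventually.of_forall fun y => ?_)
  rw [Pi.mul_apply, norm_mul, norm_norm, norm_norm]
  exact abs_real_inner_le_norm (u y) (v y)

lemma integrable_radialFieldDeriv_mul (hε : 0 < ε) :
    Integrable fun y => radialFieldDeriv x ε i y * ‖u y‖ ^ 2 :=
  (integrable_norm_sq u).bdd_mul (continuous_radialFieldDeriv hε).aestronglyMeasurable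
    (Eventually.of_forall fun _ => norm_radialFieldDeriv_le hε)

lemma integrable_radialField_mul {g : EuclideanSpace ℝ (Fin 3) → ℝ} (hg : Integrable g)
    (hε : 0 < ε) : Integrable fun y => radialField x ε i y * g y :=
  hg.bdd_mul (continuous_radialField hε).aestronglyMeasurable
    (Eventually.of_forall fun _ => norm_radialField_le_one hε)

lemma integral_radialFieldDeriv_mul (hε : 0 < ε) :
    ∫ y, radialFieldDeriv x ε i y * ‖u y‖ ^ 2 = -∫ y, radialField x ε i y *
      (2 * inner ℝ (u y) (fderiv ℝ (fun z => u z) y (EuclideanSpace.single i 1))) := by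
  have := integral_bilinear_hasLineDerivAt_right_eq_neg_left_of_integrable (μ := volume)
    (f := radialField x ε i) (f' := radialFieldDeriv x ε i)
    (g := fun y => ‖u y‖ ^ 2) (B := ContinuousLinearMap.mul ℝ ℝ)
    (integrable_radialFieldDeriv_mul u hε)
    (integrable_radialField_mul (integrable_inner_partial u i) hε)
    (integrable_radialField_mul (integrable_norm_sq u) hε)
    (fun _ _ => hasLineDerivAt_radialField hε) (fun y _ => hasLineDerivAt_norm_sq u _ y)
  simp only [ContinuousLinearMap.mul_apply'] at this
  rw [this, neg_neg]

lemma neg_sum_radialField_mul_le (hε : 0 < ε) :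
    -∑ i, radialField x ε i y *
      (2 * inner ℝ (u y) (fderiv ℝ (fun z => u z) y (EuclideanSpace.single i 1))) ≤
      2 * (‖u y‖ * gradNorm u y) := by
  have h1 : ∑ i, |radialField x ε i y| *
      ‖fderiv ℝ (fun z => u z) y (EuclideanSpace.single i 1)‖ ≤ gradNorm u y := by
    refine (Real.sum_mul_le_sqrt_mul_sqrt _ _ _).trans ?_
    simp only [sq_abs]
    refine mul_le_of_le_one_left (Real.sqrt_nonneg _) ?_
    exact Real.sqrt_le_one.2 (sum_sq_radialField_le_one hε)
  calc _ ≤ ∑ i, 2 * (‖u y‖ * (|radialField x ε i y| *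
        ‖fderiv ℝ (fun z => u z) y (EuclideanSpace.single i 1)‖)) := by
        rw [← Finset.sum_neg_distrib]
        refine Finset.sum_le_sum fun i _ => (neg_le_abs _).trans ?_
        rw [abs_mul, abs_mul, abs_two]
        nlinarith [mul_le_mul_of_nonneg_left (abs_real_inner_le_norm (u y)
          (fderiv ℝ (fun z => u z) y (EuclideanSpace.single i 1)))
          (abs_nonneg (radialField x ε i y))]
    _ ≤ _ := by
        rw [← Finset.mul_sum, ← Finset.mul_sum]
        gcongr

/-- The Coulomb bound with the kernel `1 / ‖x - y‖` regularized at the singularity. -/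
lemma integral_norm_sq_mul_inv_sqrt_reg_le (hε : 0 < ε) :
    ∫ y, (√(‖y - x‖ ^ 2 + ε))⁻¹ * ‖u y‖ ^ 2 ≤ ∫ y, ‖u y‖ * gradNorm u y := by
  have hint : Integrable fun y => (√(‖y - x‖ ^ 2 + ε))⁻¹ * ‖u y‖ ^ 2 :=
    (integrable_norm_sq u).bdd_mul (continuous_inv_sqrt_reg hε).aestronglyMeasurable
      (Eventually.of_forall fun y => by
        rw [Real.norm_of_nonneg (by positivity)]; exact inv_sqrt_reg_le hε)
  refine le_of_mul_le_mul_left ?_ (two_pos (α := ℝ))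
  calc _ = ∫ y, 2 * ((√(‖y - x‖ ^ 2 + ε))⁻¹ * ‖u y‖ ^ 2) := (integral_const_mul _ _).symm
    _ ≤ ∫ y, ∑ i, radialFieldDeriv x ε i y * ‖u y‖ ^ 2 := by
        refine integral_mono (hint.const_mul 2)
          (integrable_finsetSum _ fun i _ => integrable_radialFieldDeriv_mul u hε) fun y => ?_
        simp only [← Finset.sum_mul, ← mul_assoc]
        exact mul_le_mul_of_nonneg_right (two_mul_le_sum_radialFieldDeriv hε) (sq_nonneg _)
    _ = ∫ y, -∑ i, radialField x ε i y *
          (2 * inner ℝ (u y) (fderiv ℝ (fun z => u z) y (EuclideanSpace.single i 1))) := by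
        rw [integral_finsetSum _ fun i _ => integrable_radialFieldDeriv_mul u hε, integral_neg,
          integral_finsetSum _ fun i _ =>
            integrable_radialField_mul (integrable_inner_partial u i) hε,
          ← Finset.sum_neg_distrib]
        exact Finset.sum_congr rfl fun i _ => integral_radialFieldDeriv_mul u hε
    _ ≤ ∫ y, 2 * (‖u y‖ * gradNorm u y) := by
        refine integral_mono (integrable_finsetSum _ fun i _ =>
          integrable_radialField_mul (integrable_inner_partial u i) hε).neg
          (((u.memLp 2).norm.integrable_mul (memLp_gradNorm u)).const_mul 2)
          fun y => neg_sum_radialField_mul_le u hε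
    _ = _ := integral_const_mul _ _

end CoulombHydrogen

open CoulombHydrogen in
/-- Hydrogen bound for the Coulomb potential: for every Schwartz function `u` on
`ℝ³` and every `x ∈ ℝ³`, `∫ |u(y)|²/|x−y| dy ≤ ‖u‖_{L²} ‖∇u‖_{L²}`. -/
theorem coulomb_hydrogen_bound (u : SchwartzMap (EuclideanSpace ℝ (Fin 3)) ℂ)
    (x : EuclideanSpace ℝ (Fin 3)) :
    ∫ y : EuclideanSpace ℝ (Fin 3), ‖u y‖ ^ 2 / ‖x - y‖ ≤
      Real.sqrt (∫ y : EuclideanSpace ℝ (Fin 3), ‖u y‖ ^ 2) *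
        Real.sqrt (∫ y : EuclideanSpace ℝ (Fin 3),
          ∑ i, ‖fderiv ℝ (fun z => u z) y (EuclideanSpace.single i 1)‖ ^ 2) := by
  by_cases hint : Integrable fun y => ‖u y‖ ^ 2 / ‖x - y‖
  swap
  · rw [integral_undef hint]
    positivity
  refine le_trans ?_ (integral_norm_mul_gradNorm_le u)
  have hpos (n : ℕ) : (0 : ℝ) < 1 / ((n : ℝ) + 1) := by positivity
  have hne : ∀ᵐ y : EuclideanSpace ℝ (Fin 3), y ≠ x := Measure.ae_ne volume x
  refine le_of_tendsto (tendsto_integral_of_dominated_convergence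
    (F := fun (n : ℕ) y => (√(‖y - x‖ ^ 2 + 1 / ((n : ℝ) + 1)))⁻¹ * ‖u y‖ ^ 2) _
    (fun n => ?_) hint (fun n => ?_) ?_)
    (Eventually.of_forall fun n => integral_norm_sq_mul_inv_sqrt_reg_le u (hpos n))
  · exact ((continuous_inv_sqrt_reg (hpos n)).mul (by fun_prop)).aestronglyMeasurable
  · filter_upwards [hne] with y hy
    have hy' : 0 < ‖y - x‖ := norm_pos_iff.2 (sub_ne_zero.2 hy)
    rw [Real.norm_of_nonneg (by positivity), div_eq_inv_mul (‖u y‖ ^ 2), norm_sub_rev x y]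
    gcongr
    exact Real.le_sqrt_of_sq_le (le_add_of_nonneg_right (hpos n).le)
  · filter_upwards [hne] with y hy
    have hy' : ‖y - x‖ ≠ 0 := norm_ne_zero_iff.2 (sub_ne_zero.2 hy)
    rw [div_eq_inv_mul, norm_sub_rev x y]
    refine Tendsto.mul_const _ (Tendsto.inv₀ ?_ hy')
    have := (tendsto_one_div_add_atTop_nhds_zero_nat (𝕜 := ℝ)).const_add (‖y - x‖ ^ 2)
    simpa using this.sqrt
end
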